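/- Fix r > 1. Let J ⊆ ℝ be an interval of parameters and let I = [c, d] ⊆ ℝ be a compact interval such that for every a ∈ J the map f_a maps I into itself. Then the function a ↦ h_top(f_a|_I), assigning to each a ∈ J the topological entropy of the restriction of f_a to I, is continuous on J. -/

import Mathlib

/-- The power-law unimodal map `f_a(x) = a - |x|^r` (with `|x|^r` the real power
`Real.rpow |x| r`). -/
noncomputable def powerLawMap (a r : ℝ) : ℝ → ℝ := fun x => a - |x| ^ r


namespace PLM

open Set Filter Topology

lemma entropy_le (f : ℝ → ℝ) (I : Set ℝ) (y : ℝ)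
    (h : ∀ ε > 0, ∀ᶠ n : ℕ in atTop, ∃ s : Finset ℝ,
      (∀ x ∈ I, ∃ z ∈ s, ∀ k < n, |f^[k] x - f^[k] z| < ε) ∧ (s.card : ℝ) ≤ Real.exp (y * n)) :
    Dynamics.coverEntropy f I ≤ (y : EReal) := by
  rw [Dynamics.coverEntropy_eq_iSup_basis Metric.uniformity_basis_dist]
  refine iSup₂_le fun ε hε => ?_
  unfold Dynamics.coverEntropyEntourage
  apply Eventually.expGrowthSup_le
  filter_upwards [h ε hε] with n hn
  obtain ⟨s, hs, hc⟩ := hn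
  have hcov : Dynamics.IsDynCoverOf f I {p : ℝ × ℝ | dist p.1 p.2 < ε} n (s : Set ℝ) := by
    intro x hx
    obtain ⟨z, hz, hk⟩ := hs x hx
    refine ⟨z, hz, ?_⟩
    rw [Dynamics.mem_dynEntourage]
    intro k hkn
    simpa [Real.dist_eq] using hk k hkn
  have h1 := hcov.coverMincard_le_card
  have h2 : ((Dynamics.coverMincard f I {p : ℝ × ℝ | dist p.1 p.2 < ε} n : ℕ∞) : ENNReal)
      ≤ ((s.card : ℕ∞) : ENNReal) := ENat.toENNReal_mono h1
  refine h2.trans ?_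
  have : ((y : EReal) * (n : EReal)) = ((y * n : ℝ) : EReal) := by
    push_cast; rfl
  rw [this, EReal.exp_coe]
  rw [ENat.toENNReal_coe, ← ENNReal.ofReal_natCast]
  exact ENNReal.ofReal_le_ofReal hc

lemma le_entropy (f : ℝ → ℝ) (I : Set ℝ) (y δ : ℝ) (hδ : 0 < δ) (M k : ℕ) (hM : 1 ≤ M)
    (hk : Real.exp (y * M) ≤ k)
    (h : ∀ q : ℕ, ∃ s : Finset ℝ, (s : Set ℝ) ⊆ I ∧ s.card = k ^ q ∧
      ∀ x ∈ s, ∀ z ∈ s, x ≠ z → ∃ j < M * q, δ ≤ |f^[j] x - f^[j] z|) :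
    (y : EReal) ≤ Dynamics.coverEntropy f I := by
  rw [Dynamics.coverEntropy_eq_iSup_basis_netEntropyEntourage Metric.uniformity_basis_dist]
  refine le_iSup₂_of_le (δ/2) (by positivity) ?_
  unfold Dynamics.netEntropyEntourage
  apply Frequently.le_expGrowthSup
  rw [Filter.frequently_atTop]
  intro q
  refine ⟨M * q, Nat.le_mul_of_pos_left q hM, ?_⟩
  obtain ⟨s, hsI, hcard, hsep⟩ := h q
  have hnet : Dynamics.IsDynNetIn f I {p : ℝ × ℝ | dist p.1 p.2 < δ/2} (M * q) (s : Set ℝ) := by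
    refine ⟨hsI, ?_⟩
    intro x hx z hz hxz
    rw [Function.onFun, Set.disjoint_left]
    intro w hw1 hw2
    rw [Dynamics.mem_ball_dynEntourage] at hw1 hw2
    obtain ⟨j, hj, hd⟩ := hsep x hx z hz hxz
    have h1 : dist (f^[j] x) (f^[j] w) < δ/2 := hw1 j hj
    have h2 : dist (f^[j] z) (f^[j] w) < δ/2 := hw2 j hj
    have h3 := dist_triangle_right (f^[j] x) (f^[j] z) (f^[j] w)
    rw [Real.dist_eq (f^[j] x) (f^[j] z)] at h3
    linarith
  have h1 := hnet.card_le_netMaxcard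
  have h2 : ((s.card : ℕ∞) : ENNReal) ≤
    ((Dynamics.netMaxcard f I {p : ℝ × ℝ | dist p.1 p.2 < δ/2} (M*q) : ℕ∞) : ENNReal)
       := ENat.toENNReal_mono h1
  refine le_trans ?_ h2
  have : ((y : EReal) * ((M * q : ℕ) : EReal)) = ((y * (M * q : ℕ) : ℝ) : EReal) := by
    push_cast; rfl
  rw [this, EReal.exp_coe]
  rw [ENat.toENNReal_coe, ← ENNReal.ofReal_natCast]
  apply ENNReal.ofReal_le_ofReal
  rw [hcard]
  push_cast
  rw [← mul_assoc, mul_comm _ (q:ℝ), Real.exp_nat_mul]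
  gcongr


/-- The sign word of length `n` of the point `x`: the set of times at which the orbit is negative. -/
noncomputable def wd (f : ℝ → ℝ) (n : ℕ) (x : ℝ) : Finset ℕ :=
  (Finset.range n).filter (fun i => f^[i] x < 0)

/-- Points of `I` whose orbit avoids `U` before time `n`. -/
def Av (f : ℝ → ℝ) (U I : Set ℝ) (n : ℕ) : Set ℝ := {x | x ∈ I ∧ ∀ i < n, f^[i] x ∉ U}

/-- The number of words of orbits avoiding `U`. -/
noncomputable def vc (f : ℝ → ℝ) (U I : Set ℝ) (n : ℕ) : ℕ := (wd f n '' Av f U I n).ncard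

lemma mem_wd {f : ℝ → ℝ} {n : ℕ} {x : ℝ} {i : ℕ} : i ∈ wd f n x ↔ i < n ∧ f^[i] x < 0 := by
  simp [wd]

lemma wd_image_subset (f : ℝ → ℝ) (n : ℕ) (R : Set ℝ) :
    wd f n '' R ⊆ ((Finset.range n).powerset : Finset (Finset ℕ)) := by
  rintro _ ⟨x, -, rfl⟩
  simp only [Finset.coe_powerset, mem_preimage, mem_powerset_iff, Finset.coe_subset]
  exact Finset.filter_subset _ _

lemma wd_finite (f : ℝ → ℝ) (n : ℕ) (R : Set ℝ) : (wd f n '' R).Finite :=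
  (Finset.finite_toSet _).subset (wd_image_subset f n R)

lemma wd_ncard_le (f : ℝ → ℝ) (n : ℕ) (R : Set ℝ) : (wd f n '' R).ncard ≤ 2 ^ n := by
  have := Set.ncard_le_ncard (wd_image_subset f n R) (Finset.finite_toSet _)
  rwa [Set.ncard_coe_finset, Finset.card_powerset, Finset.card_range] at this

lemma wd_add (f : ℝ → ℝ) (m n : ℕ) (x : ℝ) :
    wd f (m + n) x = wd f m x ∪ (wd f n (f^[m] x)).image (· + m) := by
  ext i
  simp only [mem_wd, Finset.mem_union, Finset.mem_image]
  constructor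
  · rintro ⟨h1, h2⟩
    by_cases h : i < m
    · exact Or.inl ⟨h, h2⟩
    · right
      refine ⟨i - m, ⟨by omega, ?_⟩, by omega⟩
      rw [← Function.iterate_add_apply]
      rwa [show i - m + m = i by omega]
  · rintro (⟨h1, h2⟩ | ⟨j, ⟨h1, h2⟩, rfl⟩)
    · exact ⟨by omega, h2⟩
    · rw [← Function.iterate_add_apply] at h2
      exact ⟨by omega, h2⟩

lemma vc_add_le (f : ℝ → ℝ) (U I : Set ℝ) (hI : MapsTo f I I) (m n : ℕ) :
    vc f U I (m + n) ≤ vc f U I m * vc f U I n := by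
  unfold vc
  rw [← Set.ncard_prod]
  have hsub : wd f (m + n) '' Av f U I (m + n) ⊆
      (fun p : Finset ℕ × Finset ℕ => p.1 ∪ p.2.image (· + m)) ''
        ((wd f m '' Av f U I m) ×ˢ (wd f n '' Av f U I n)) := by
    rintro _ ⟨x, ⟨hx, hU⟩, rfl⟩
    refine ⟨(wd f m x, wd f n (f^[m] x)), ⟨⟨x, ⟨hx, fun i hi => hU i (by omega)⟩, rfl⟩,
      ⟨f^[m] x, ⟨hI.iterate m hx, fun i hi => ?_⟩, rfl⟩⟩, (wd_add f m n x).symm⟩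
    rw [← Function.iterate_add_apply]
    exact hU _ (by omega)
  have hfin := (wd_finite f m (Av f U I m)).prod (wd_finite f n (Av f U I n))
  exact (Set.ncard_le_ncard hsub (hfin.image _)).trans (Set.ncard_image_le hfin)

lemma vc_mul_le (f : ℝ → ℝ) (U I : Set ℝ) (hI : MapsTo f I I) (N q : ℕ) :
    vc f U I (N * q) ≤ vc f U I N ^ q := by
  induction q with
  | zero => simpa [vc] using wd_ncard_le f 0 (Av f U I 0)
  | succ q ih =>
    rw [Nat.mul_succ, pow_succ]
    exact (vc_add_le f U I hI _ _).trans (Nat.mul_le_mul_right _ ih)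

lemma vc_bound (f : ℝ → ℝ) (U I : Set ℝ) (hI : MapsTo f I I) (N B : ℕ) (hN : 1 ≤ N) (hB : 1 ≤ B)
    (h : vc f U I N ≤ B) (i n : ℕ) (hin : i ≤ n) : vc f U I i ≤ B ^ (n / N) * 2 ^ N := by
  conv_lhs => rw [← Nat.div_add_mod i N]
  refine (vc_add_le f U I hI _ _).trans ?_
  have h1 : vc f U I (N * (i / N)) ≤ B ^ (n / N) :=
    (vc_mul_le f U I hI N (i / N)).trans ((Nat.pow_le_pow_left h _).trans
      (Nat.pow_le_pow_right hB (Nat.div_le_div_right hin)))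
  have h2 : vc f U I (i % N) ≤ 2 ^ N := (wd_ncard_le f _ _).trans
    (Nat.pow_le_pow_right (by norm_num) (Nat.mod_lt _ hN).le)
  exact Nat.mul_le_mul h1 h2

/-- Orientation of the `j`-th iterate along the word `u`. -/
def sg (u : Finset ℕ) (j : ℕ) : ℤ := ∏ i ∈ Finset.range j, if i ∈ u then 1 else -1

lemma sg_cases (u : Finset ℕ) (j : ℕ) : sg u j = 1 ∨ sg u j = -1 := by
  induction j with
  | zero => left; simp [sg]
  | succ j ih =>
    have : sg u (j+1) = sg u j * (if j ∈ u then 1 else -1) := by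
      simp [sg, Finset.prod_range_succ]
    rw [this]
    split_ifs <;> rcases ih with h | h <;> simp [h]

lemma sg_mono {f : ℝ → ℝ} (hmono : MonotoneOn f (Iic 0)) (hanti : AntitoneOn f (Ici 0))
    {n : ℕ} {x y : ℝ} (hxy : x ≤ y) (hw : wd f n x = wd f n y) (j : ℕ) (hj : j ≤ n) :
    (sg (wd f n x) j = 1 ∧ f^[j] x ≤ f^[j] y) ∨ (sg (wd f n x) j = -1 ∧ f^[j] y ≤ f^[j] x) := by
  induction j with
  | zero => left; simp [sg, hxy]
  | succ j ih =>
    have hs : sg (wd f n x) (j+1) = sg (wd f n x) j * (if j ∈ wd f n x then 1 else -1) := by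
      simp [sg, Finset.prod_range_succ]
    rw [hs]
    simp only [Function.iterate_succ_apply']
    have ih := ih (by omega)
    by_cases hneg : j ∈ wd f n x
    · have hneg' := hneg
      rw [hw] at hneg'
      have h1 := (mem_wd.1 hneg).2.le
      have h2 := (mem_wd.1 hneg').2.le
      simp only [hneg, if_true, mul_one]
      rcases ih with ⟨h, h'⟩ | ⟨h, h'⟩
      · exact Or.inl ⟨h, hmono h1 h2 h'⟩
      · exact Or.inr ⟨h, hmono h2 h1 h'⟩
    · have hneg' := hneg
      rw [hw] at hneg'
      rw [mem_wd] at hneg hneg'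
      have h1 : 0 ≤ f^[j] x := by by_contra hc; exact hneg ⟨by omega, by linarith⟩
      have h2 : 0 ≤ f^[j] y := by by_contra hc; exact hneg' ⟨by omega, by linarith⟩
      have hneg3 : j ∉ wd f n x := by rw [mem_wd]; exact hneg
      simp only [hneg3, if_false]
      rcases ih with ⟨h, h'⟩ | ⟨h, h'⟩
      · exact Or.inr ⟨by simp [h], hanti h1 h2 h'⟩
      · exact Or.inl ⟨by simp [h], hanti h2 h1 h'⟩

/-- The integer-valued monotone coordinate on a cylinder. -/
noncomputable def gc (f : ℝ → ℝ) (ε : ℝ) (n : ℕ) (x : ℝ) : ℤ :=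
  ∑ j ∈ Finset.range n, sg (wd f n x) j * ⌊f^[j] x / ε⌋

lemma gc_close {f : ℝ → ℝ} (hmono : MonotoneOn f (Iic 0)) (hanti : AntitoneOn f (Ici 0))
    {ε : ℝ} (hε : 0 < ε) {n : ℕ} {x y : ℝ} (hw : wd f n x = wd f n y)
    (hg : gc f ε n x = gc f ε n y) (j : ℕ) (hj : j < n) : |f^[j] x - f^[j] y| < ε := by
  wlog hxy : x ≤ y generalizing x y
  · rw [abs_sub_comm]
    exact this hw.symm hg.symm (by linarith)
  have key : ∑ j ∈ Finset.range n, sg (wd f n x) j * (⌊f^[j] y / ε⌋ - ⌊f^[j] x / ε⌋) = 0 := by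
    unfold gc at hg
    rw [← hw] at hg
    simp only [mul_sub, Finset.sum_sub_distrib]
    linarith
  have hnn : ∀ j ∈ Finset.range n, 0 ≤ sg (wd f n x) j * (⌊f^[j] y / ε⌋ - ⌊f^[j] x / ε⌋) := by
    intro j hj
    rcases sg_mono hmono hanti hxy hw j (Finset.mem_range.1 hj).le with ⟨h, h'⟩ | ⟨h, h'⟩
    · rw [h]
      have : ⌊f^[j] x / ε⌋ ≤ ⌊f^[j] y / ε⌋ := Int.floor_le_floor (by gcongr)
      linarith
    · rw [h]
      have : ⌊f^[j] y / ε⌋ ≤ ⌊f^[j] x / ε⌋ := Int.floor_le_floor (by gcongr)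
      linarith
  have h0 := (Finset.sum_eq_zero_iff_of_nonneg hnn).1 key j (Finset.mem_range.2 hj)
  have h1 : ⌊f^[j] x / ε⌋ = ⌊f^[j] y / ε⌋ := by
    rcases sg_cases (wd f n x) j with h | h <;> rw [h] at h0 <;> linarith
  have h2 := Int.abs_sub_lt_one_of_floor_eq_floor h1
  rw [← sub_div, abs_div, abs_of_pos hε, div_lt_one hε] at h2
  exact h2

lemma floor_abs_le {C ε x : ℝ} (hε : 0 < ε) (hx : |x| ≤ C) : |⌊x / ε⌋| ≤ ((⌈C / ε⌉₊ + 1 : ℕ) : ℤ) := by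
  have h1 : |x / ε| ≤ ⌈C / ε⌉₊ := by
    rw [abs_div, abs_of_pos hε]
    exact (div_le_div_of_nonneg_right hx hε.le).trans (Nat.le_ceil _)
  rw [abs_le] at h1 ⊢
  have h2 := Int.floor_le (x / ε)
  have h3 := Int.lt_floor_add_one (x / ε)
  constructor
  · have : ((-((⌈C / ε⌉₊ + 1 : ℕ) : ℤ) : ℤ) : ℝ) ≤ (⌊x / ε⌋ : ℝ) := by push_cast; linarith
    exact_mod_cast this
  · have : (⌊x / ε⌋ : ℝ) ≤ (((⌈C / ε⌉₊ + 1 : ℕ) : ℤ) : ℝ) := by push_cast; linarith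
    exact_mod_cast this

lemma gc_abs_le {f : ℝ → ℝ} {C ε : ℝ} (hε : 0 < ε) {n : ℕ} {x : ℝ}
    (hx : ∀ j, |f^[j] x| ≤ C) : |gc f ε n x| ≤ (n * (⌈C / ε⌉₊ + 1) : ℕ) := by
  unfold gc
  refine (Finset.abs_sum_le_sum_abs _ _).trans ?_
  have : ∀ j ∈ Finset.range n, |sg (wd f n x) j * ⌊f^[j] x / ε⌋| ≤ ((⌈C / ε⌉₊ + 1 : ℕ) : ℤ) := by
    intro j _
    rw [abs_mul]
    have : |sg (wd f n x) j| = 1 := by rcases sg_cases (wd f n x) j with h | h <;> simp [h]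
    rw [this, one_mul]
    exact floor_abs_le hε (hx j)
  refine (Finset.sum_le_card_nsmul _ _ _ this).trans ?_
  simp

/-- Covering number estimate. -/
lemma cover_card {f : ℝ → ℝ} (hmono : MonotoneOn f (Iic 0)) (hanti : AntitoneOn f (Ici 0))
    {I : Set ℝ} (hI : MapsTo f I I) {C : ℝ} (hC : ∀ x ∈ I, |x| ≤ C) (U : Set ℝ)
    {ε δ : ℝ} (hε : 0 < ε) (hδ : 0 < δ)
    (hU : ∀ x ∈ U, ∀ y ∈ U, |x - y| < δ → ∀ i, |f^[i] x - f^[i] y| < ε) (n D : ℕ)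
    (hD : ∀ i ≤ n, vc f U I i ≤ D) :
    ∃ s : Finset ℝ, (∀ x ∈ I, ∃ z ∈ s, ∀ k < n, |f^[k] x - f^[k] z| < ε) ∧
      s.card ≤ (n + 1) * (D * ((2 * (n * (⌈C / ε⌉₊ + 1)) + 1) * (2 * (⌈C / δ⌉₊ + 1) + 1))) := by
  classical
  have hone : ∀ i ≤ n, ∃ s : Finset ℝ,
      (∀ x ∈ Av f U I i, (i = n ∨ f^[i] x ∈ U) → ∃ z ∈ s, ∀ k < n, |f^[k] x - f^[k] z| < ε) ∧
      s.card ≤ D * ((2 * (n * (⌈C / ε⌉₊ + 1)) + 1) * (2 * (⌈C / δ⌉₊ + 1) + 1)) := by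
    intro i hi
    set X : Set ℝ := {x | x ∈ Av f U I i ∧ (i = n ∨ f^[i] x ∈ U)} with hX
    set φ : ℝ → Finset ℕ × ℤ × ℤ := fun x => (wd f i x, gc f ε i x, ⌊f^[i] x / δ⌋) with hφ
    set P : ℕ := n * (⌈C / ε⌉₊ + 1) with hP
    set Q : ℕ := ⌈C / δ⌉₊ + 1 with hQ
    set t : Finset (Finset ℕ × ℤ × ℤ) := (wd_finite f i (Av f U I i)).toFinset ×ˢ
      (Finset.Icc (-(P:ℤ)) P ×ˢ Finset.Icc (-(Q:ℤ)) Q) with ht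
    have htc : t.card ≤ D * ((2 * P + 1) * (2 * Q + 1)) := by
      rw [ht, Finset.card_product, Finset.card_product, Int.card_Icc, Int.card_Icc,
        ← Set.ncard_eq_toFinset_card _ (wd_finite f i (Av f U I i))]
      have e1 : ((P:ℤ) + 1 - -(P:ℤ)).toNat = 2 * P + 1 := by omega
      have e2 : ((Q:ℤ) + 1 - -(Q:ℤ)).toNat = 2 * Q + 1 := by omega
      rw [e1, e2]
      exact Nat.mul_le_mul_right _ (hD i hi)
    have hXt : ∀ x ∈ X, φ x ∈ t := by
      rintro x ⟨hx, -⟩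
      have hb : ∀ j, |f^[j] x| ≤ C := fun j => hC _ (hI.iterate j hx.1)
      have h1 := gc_abs_le hε (n := i) hb
      have h2 := floor_abs_le hδ (hb i)
      have h3 : ((i * (⌈C / ε⌉₊ + 1) : ℕ) : ℤ) ≤ (P : ℤ) := by
        rw [hP]; exact_mod_cast Nat.mul_le_mul_right _ hi
      rw [abs_le] at h1 h2
      simp only [ht, hφ, Finset.mem_product, Finset.mem_Icc, Set.Finite.mem_toFinset]
      refine ⟨⟨x, hx, rfl⟩, ⟨by linarith [h1.1], by linarith [h1.2]⟩, h2.1, h2.2⟩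
    choose! g hg using (fun (w : Finset ℕ × ℤ × ℤ) (hw : w ∈ φ '' X) => hw)
    refine ⟨t.image g, ?_, Finset.card_image_le.trans htc⟩
    intro x hx hxi
    have hxX : x ∈ X := ⟨hx, hxi⟩
    refine ⟨g (φ x), Finset.mem_image_of_mem _ (hXt x hxX), ?_⟩
    obtain ⟨hgX, hge⟩ := hg (φ x) ⟨x, hxX, rfl⟩
    set z := g (φ x) with hz
    simp only [hφ, Prod.mk.injEq] at hge
    obtain ⟨e1, e2, e3⟩ := hge
    intro k hk
    by_cases hki : k < i
    · exact gc_close hmono hanti hε e1.symm e2.symm k hki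
    · have hin : i ≠ n := by omega
      have hx1 : f^[i] x ∈ U := hxi.resolve_left hin
      have hz1 : f^[i] z ∈ U := hgX.2.resolve_left hin
      have h2 := Int.abs_sub_lt_one_of_floor_eq_floor e3.symm
      rw [← sub_div, abs_div, abs_of_pos hδ, div_lt_one hδ] at h2
      have h3 := hU _ hx1 _ hz1 h2 (k - i)
      rwa [← Function.iterate_add_apply, ← Function.iterate_add_apply,
        show k - i + i = k by omega] at h3
  choose! S hS1 hS2 using hone
  refine ⟨(Finset.range (n+1)).biUnion S, ?_, ?_⟩
  · intro x hx
    have : ∃ i ≤ n, x ∈ Av f U I i ∧ (i = n ∨ f^[i] x ∈ U) := by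
      by_cases h : ∃ i, i < n ∧ f^[i] x ∈ U
      · refine ⟨Nat.find h, (Nat.find_spec h).1.le, ⟨hx, fun j hj hjU => ?_⟩,
          Or.inr (Nat.find_spec h).2⟩
        exact Nat.find_min h hj ⟨hj.trans (Nat.find_spec h).1, hjU⟩
      · push Not at h
        exact ⟨n, le_rfl, ⟨hx, h⟩, Or.inl rfl⟩
    obtain ⟨i, hi, hx1, hx2⟩ := this
    obtain ⟨z, hz, hk⟩ := hS1 i hi x hx1 hx2
    exact ⟨z, Finset.mem_biUnion.2 ⟨i, Finset.mem_range.2 (by omega), hz⟩, hk⟩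
  · have := Finset.card_biUnion_le_card_mul (Finset.range (n+1)) S _
      (fun i hi => hS2 i (by have := Finset.mem_range.1 hi; omega))
    simpa using this

/-- Upper bound for the entropy by the number of words. -/
lemma entropy_le_words {f : ℝ → ℝ} (hmono : MonotoneOn f (Iic 0)) (hanti : AntitoneOn f (Ici 0))
    {I : Set ℝ} (hI : MapsTo f I I) {C : ℝ} (hC : ∀ x ∈ I, |x| ≤ C) (U : Set ℝ)
    (hU : ∀ ε > 0, ∃ δ > 0, ∀ x ∈ U, ∀ y ∈ U, |x - y| < δ → ∀ i, |f^[i] x - f^[i] y| < ε)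
    (N B : ℕ) (hN : 1 ≤ N) (hB : 1 ≤ B) (hv : vc f U I N ≤ B) (y : ℝ)
    (hy : (B : ℝ) < Real.exp (y * N)) :
    Dynamics.coverEntropy f I ≤ (y : EReal) := by
  apply entropy_le
  intro ε hε
  obtain ⟨δ, hδ, hU'⟩ := hU ε hε
  obtain ⟨b, hb0, hby, hbB⟩ : ∃ b : ℝ, 0 < b ∧ b < Real.exp y ∧ (B : ℝ) = b ^ N := by
    refine ⟨(B : ℝ) ^ ((N : ℝ)⁻¹), by positivity, ?_, ?_⟩
    · rw [mul_comm, Real.exp_nat_mul] at hy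
      have h1 := Real.rpow_lt_rpow (by positivity) hy (z := (N : ℝ)⁻¹) (by positivity)
      rwa [Real.pow_rpow_inv_natCast (Real.exp_pos y).le (by omega)] at h1
    · rw [Real.rpow_inv_natCast_pow (by positivity) (by omega)]
  have hb1 : 1 ≤ b := by
    by_contra hc
    push Not at hc
    have : b ^ N < 1 := pow_lt_one₀ hb0.le hc (by omega)
    have : (1:ℝ) ≤ B := by exact_mod_cast hB
    linarith
  set P : ℕ := ⌈C / ε⌉₊ + 1 with hP
  set Q : ℕ := 2 * (⌈C / δ⌉₊ + 1) + 1 with hQ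
  set c : ℝ := 2 ^ N * (2 * P + 1) * Q with hc
  have hq : Tendsto (fun n : ℕ => c * ((n + 1 : ℝ) ^ 2 * (b / Real.exp y) ^ n)) atTop (𝓝 0) := by
    have hr1 : b / Real.exp y < 1 := by rw [div_lt_one (Real.exp_pos y)]; exact hby
    have hr0 : 0 < b / Real.exp y := by positivity
    have h1 := tendsto_pow_const_mul_const_pow_of_lt_one 2 hr0.le hr1
    have h2 := (h1.comp (tendsto_add_atTop_nat 1)).const_mul (c / (b / Real.exp y))
    rw [mul_zero] at h2
    refine h2.congr fun n => ?_
    simp only [Function.comp]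
    push_cast
    rw [pow_succ (b / Real.exp y)]
    field_simp
  filter_upwards [hq.eventually (gt_mem_nhds (show (0:ℝ) < 1 by norm_num))] with n hn
  obtain ⟨s, hs1, hs2⟩ := cover_card hmono hanti hI hC U hε hδ hU' n (B ^ (n / N) * 2 ^ N)
    (fun i hi => vc_bound f U I hI N B hN hB hv i n hi)
  refine ⟨s, hs1, ?_⟩
  have h1 : (s.card : ℝ) ≤ (n + 1) * ((B:ℝ) ^ (n / N) * 2 ^ N * ((2 * (n * P) + 1) * Q)) := by
    exact_mod_cast hs2
  have h2 : (B : ℝ) ^ (n / N) ≤ b ^ n := by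
    rw [hbB, ← pow_mul]
    exact pow_le_pow_right₀ hb1 (Nat.mul_div_le n N)
  have h3 : (2 * (n * (P:ℝ)) + 1) ≤ (n + 1) * (2 * P + 1) := by
    have : (0:ℝ) ≤ n := n.cast_nonneg
    have : (0:ℝ) ≤ P := P.cast_nonneg
    nlinarith
  have h4 : (s.card : ℝ) ≤ (n + 1) * (b ^ n * 2 ^ N * (((n + 1) * (2 * P + 1)) * Q)) :=
    h1.trans (by gcongr)
  have h5 : c * ((n + 1 : ℝ) ^ 2 * (b / Real.exp y) ^ n) * Real.exp (y * n)
      = (n + 1) * (b ^ n * 2 ^ N * (((n + 1) * (2 * P + 1)) * Q)) := by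
    rw [mul_comm y, Real.exp_nat_mul, div_pow, hc]
    have := Real.exp_pos y
    field_simp
  rw [← h5] at h4
  have h6 := Real.exp_pos (y * n)
  nlinarith

open Classical in
/-- Weighted count of itineraries of length `n` issued from the state `R`; full letters are
restricted to `T`. -/
noncomputable def QQ (F : ℝ → ℝ) (α T : Finset (Set ℝ)) (τ : Set ℝ → ℕ) : ℕ → Set ℝ → ℕ
  | 0, R => τ R
  | n + 1, R => ∑ C ∈ α.filter (fun C => (R ∩ C).Nonempty ∧ (C ⊆ R → C ∈ T)),
      QQ F α T τ n (F '' (R ∩ C))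

open Classical in
/-- Indicator of containing `B`. -/
noncomputable def tau (B R : Set ℝ) : ℕ := if B ⊆ R then 1 else 0

lemma QQ_mono (F : ℝ → ℝ) (α T T' : Finset (Set ℝ)) (h : T ⊆ T') (τ : Set ℝ → ℕ) (n : ℕ)
    (R : Set ℝ) : QQ F α T τ n R ≤ QQ F α T' τ n R := by
  classical
  induction n generalizing R with
  | zero => exact le_rfl
  | succ n ih =>
    simp only [QQ]
    refine (Finset.sum_le_sum fun C _ => ih _).trans (Finset.sum_le_sum_of_subset ?_)
    intro C hC
    simp only [Finset.mem_filter] at hC ⊢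
    exact ⟨hC.1, hC.2.1, fun h' => h (hC.2.2 h')⟩

lemma sum_insert_step (α T : Finset (Set ℝ)) (C0 : Set ℝ) (h0 : C0 ∈ α)
    (hT : C0 ∉ T) (hne : C0.Nonempty) (R : Set ℝ) (φ : Set ℝ → ℕ) (F : ℝ → ℝ) [DecidableEq (Set ℝ)]
    [DecidablePred (fun C => (R ∩ C).Nonempty ∧ (C ⊆ R → C ∈ insert C0 T))]
    [DecidablePred (fun C => (R ∩ C).Nonempty ∧ (C ⊆ R → C ∈ T))] :
    ∑ C ∈ α.filter (fun C => (R ∩ C).Nonempty ∧ (C ⊆ R → C ∈ insert C0 T)), φ (F '' (R ∩ C)) =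
    ∑ C ∈ α.filter (fun C => (R ∩ C).Nonempty ∧ (C ⊆ R → C ∈ T)), φ (F '' (R ∩ C)) +
      tau C0 R * φ (F '' C0) := by
  by_cases hR : C0 ⊆ R
  · have : α.filter (fun C => (R ∩ C).Nonempty ∧ (C ⊆ R → C ∈ insert C0 T)) =
        insert C0 (α.filter (fun C => (R ∩ C).Nonempty ∧ (C ⊆ R → C ∈ T))) := by
      ext C
      simp only [Finset.mem_filter, Finset.mem_insert]
      constructor
      · rintro ⟨h1, h2, h3⟩
        by_cases hC : C = C0
        · exact Or.inl hC
        · exact Or.inr ⟨h1, h2, fun h => (h3 h).resolve_left hC⟩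
      · rintro (rfl | ⟨h1, h2, h3⟩)
        · exact ⟨h0, by rwa [inter_eq_self_of_subset_right hR], fun _ => Or.inl rfl⟩
        · exact ⟨h1, h2, fun h => Or.inr (h3 h)⟩
    rw [this, Finset.sum_insert (by
      simp only [Finset.mem_filter, not_and]
      intro _ _ h
      exact hT (h hR)), inter_eq_self_of_subset_right hR]
    simp [tau, hR, add_comm]
  · have : α.filter (fun C => (R ∩ C).Nonempty ∧ (C ⊆ R → C ∈ insert C0 T)) =
        (α.filter (fun C => (R ∩ C).Nonempty ∧ (C ⊆ R → C ∈ T))) := by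
      ext C
      simp only [Finset.mem_filter, Finset.mem_insert]
      constructor
      · rintro ⟨h1, h2, h3⟩
        refine ⟨h1, h2, fun h => (h3 h).resolve_left ?_⟩
        rintro rfl
        exact hR h
      · rintro ⟨h1, h2, h3⟩
        exact ⟨h1, h2, fun h => Or.inr (h3 h)⟩
    rw [this]
    simp [tau, hR]

open Classical in
/-- Decomposition according to the first full visit. -/
lemma QQ_first (F : ℝ → ℝ) (α T : Finset (Set ℝ)) (C0 : Set ℝ) (h0 : C0 ∈ α)
    (hT : C0 ∉ T) (hne : C0.Nonempty) (τ : Set ℝ → ℕ) (n : ℕ) (R : Set ℝ) :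
    QQ F α (insert C0 T) τ n R = QQ F α T τ n R +
      ∑ i ∈ Finset.range n, QQ F α T (tau C0) i R * QQ F α (insert C0 T) τ (n - 1 - i) (F '' C0) := by
  induction n generalizing R with
  | zero => simp [QQ]
  | succ n ih =>
    rw [QQ, sum_insert_step α T C0 h0 hT hne R _ F]
    simp_rw [ih (F '' (R ∩ _))]
    rw [Finset.sum_add_distrib, Finset.sum_comm, Finset.sum_range_succ']
    simp_rw [← Finset.sum_mul]
    simp only [QQ, Nat.add_sub_cancel, Nat.sub_zero]
    rw [add_assoc]
    congr 2
    refine Finset.sum_congr rfl fun i _ => ?_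
    rw [show n - 1 - i = n - (i + 1) by omega]

open Classical in
/-- Decomposition according to the last full visit. -/
lemma QQ_last (F : ℝ → ℝ) (α T : Finset (Set ℝ)) (C0 : Set ℝ) (h0 : C0 ∈ α)
    (hT : C0 ∉ T) (hne : C0.Nonempty) (τ : Set ℝ → ℕ) (n : ℕ) (R : Set ℝ) :
    QQ F α (insert C0 T) τ n R = QQ F α T τ n R +
      ∑ i ∈ Finset.range n, QQ F α (insert C0 T) (tau C0) i R * QQ F α T τ (n - 1 - i) (F '' C0) := by
  induction n generalizing R with
  | zero => simp [QQ]
  | succ n ih =>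
    rw [QQ]
    simp_rw [ih (F '' (R ∩ _))]
    rw [Finset.sum_add_distrib, Finset.sum_comm, Finset.sum_range_succ']
    simp_rw [← Finset.sum_mul]
    rw [sum_insert_step α T C0 h0 hT hne R _ F]
    simp only [QQ, Nat.add_sub_cancel, Nat.sub_zero]
    rw [add_assoc]
    congr 1
    rw [add_comm]
    congr 1
    refine Finset.sum_congr rfl fun i _ => ?_
    rw [show n - 1 - i = n - (i + 1) by omega]

lemma edge_card (α : Finset (Set ℝ)) (hord : ∀ C ∈ α, C.OrdConnected)
    (hdisj : ∀ C ∈ α, ∀ D ∈ α, C ≠ D → Disjoint C D) (R : Set ℝ) (hR : R.OrdConnected)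
    [DecidablePred (fun C => (R ∩ C).Nonempty ∧ (C ⊆ R → C ∈ (∅ : Finset (Set ℝ))))] :
    (α.filter (fun C => (R ∩ C).Nonempty ∧ (C ⊆ R → C ∈ (∅ : Finset (Set ℝ))))).card ≤ 2 := by
  by_contra hcon
  push Not at hcon
  have key : ∀ A ∈ α, ∀ B ∈ α, ∀ D ∈ α, ∀ a ∈ R ∩ A, ∀ b ∈ R ∩ B, ∀ e ∈ R ∩ D,
      A ≠ B → B ≠ D → a ≤ b → b ≤ e → B ⊆ R := by
    intro A hA B hB D hD a ha b hb e he hAB hBD hab hbe z hz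
    have haz : a ≤ z := by
      by_contra h
      push Not at h
      have : a ∈ B := (hord B hB).out hz hb.2 ⟨h.le, hab⟩
      exact Set.disjoint_left.1 (hdisj A hA B hB hAB) ha.2 this
    have hze : z ≤ e := by
      by_contra h
      push Not at h
      have : e ∈ B := (hord B hB).out hb.2 hz ⟨hbe, h.le⟩
      exact Set.disjoint_left.1 (hdisj B hB D hD hBD) this he.2
    exact hR.out ha.1 he.1 ⟨haz, hze⟩
  obtain ⟨A, B, D, hA, hB, hD, hAB, hAD, hBD⟩ := Finset.two_lt_card_iff.1 hcon
  simp only [Finset.mem_filter, Finset.notMem_empty, imp_false] at hA hB hD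
  obtain ⟨hA, ⟨a, ha⟩, hAR⟩ := hA
  obtain ⟨hB, ⟨b, hb⟩, hBR⟩ := hB
  obtain ⟨hD, ⟨e, he⟩, hDR⟩ := hD
  rcases le_total a b with h1 | h1 <;> rcases le_total b e with h2 | h2 <;>
    rcases le_total a e with h3 | h3
  · exact hBR (key A hA B hB D hD a ha b hb e he hAB hBD h1 h2)
  · exact hBR (key A hA B hB D hD a ha b hb e he hAB hBD h1 h2)
  · exact hDR (key A hA D hD B hB a ha e he b hb hAD hBD.symm h3 h2)
  · exact hAR (key D hD A hA B hB e he a ha b hb hAD.symm hAB h3 h1)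
  · exact hAR (key B hB A hA D hD b hb a ha e he hAB.symm hAD h1 h3)
  · exact hDR (key B hB D hD A hA b hb e he a ha hBD hAD.symm h2 h3)
  · exact hBR (key D hD B hB A hA e he b hb a ha hBD.symm hAB.symm h2 h1)
  · exact hBR (key D hD B hB A hA e he b hb a ha hBD.symm hAB.symm h2 h1)

lemma ordConnected_image {F : ℝ → ℝ} (hF : Continuous F) {R : Set ℝ} (hR : R.OrdConnected) :
    (F '' R).OrdConnected :=
  (hR.isPreconnected.image F hF.continuousOn).ordConnected

lemma QQ_empty_le (F : ℝ → ℝ) (hF : Continuous F) (α : Finset (Set ℝ))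
    (hord : ∀ C ∈ α, C.OrdConnected)
    (hdisj : ∀ C ∈ α, ∀ D ∈ α, C ≠ D → Disjoint C D) (τ : Set ℝ → ℕ) (hτ : ∀ R, τ R ≤ 1) (n : ℕ)
    (R : Set ℝ) (hR : R.OrdConnected) : QQ F α ∅ τ n R ≤ 2 ^ n := by
  classical
  induction n generalizing R with
  | zero => simpa [QQ] using hτ R
  | succ n ih =>
    rw [QQ]
    refine (Finset.sum_le_card_nsmul _ _ (2 ^ n) ?_).trans ?_
    · intro C hC
      exact ih _ (ordConnected_image hF (hR.inter (hord C (Finset.mem_filter.1 hC).1)))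
    · rw [smul_eq_mul, pow_succ, mul_comm]
      exact Nat.mul_le_mul_left _ (edge_card α hord hdisj R hR)

lemma summable_conv {t : ℝ} (ht : 0 ≤ t) (x w : ℕ → ℕ)
    (hx : Summable fun n => (x n : ℝ) * t ^ n) (hw : Summable fun n => (w n : ℝ) * t ^ n) :
    Summable fun n => ((∑ i ∈ Finset.range n, x i * w (n - 1 - i) : ℕ) : ℝ) * t ^ n := by
  rw [← summable_nat_add_iff 1]
  have h1 := summable_norm_sum_mul_range_of_summable_norm hx.norm hw.norm
  have h2 := (h1.of_norm).mul_left t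
  refine h2.congr fun n => ?_
  push_cast
  rw [Finset.mul_sum, Finset.sum_mul]
  refine Finset.sum_congr rfl fun i hi => ?_
  have hi' : i ≤ n := by have := Finset.mem_range.1 hi; omega
  have : t ^ (n + 1) = t * (t ^ i * t ^ (n - i)) := by
    rw [← pow_add, show i + (n - i) = n by omega, pow_succ, mul_comm]
  rw [this]
  ring

lemma QQ_summable (F : ℝ → ℝ) (hF : Continuous F) (α : Finset (Set ℝ))
    (hord : ∀ C ∈ α, C.OrdConnected) (hne : ∀ C ∈ α, C.Nonempty)
    (hdisj : ∀ C ∈ α, ∀ D ∈ α, C ≠ D → Disjoint C D) (t : ℝ) (ht : 0 ≤ t) (ht2 : 2 * t < 1)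
    (hloop : ∀ C ∈ α, Summable fun n => (QQ F α α (tau C) n (F '' C) : ℝ) * t ^ n)
    (T : Finset (Set ℝ)) (hT : T ⊆ α) :
    ∀ τ : Set ℝ → ℕ, (∀ R, τ R ≤ 1) → ∀ R : Set ℝ, R.OrdConnected →
      Summable fun n => (QQ F α T τ n R : ℝ) * t ^ n := by
  classical
  have htau : ∀ C R, tau C R ≤ 1 := by
    intro C R; unfold tau; split_ifs <;> simp
  induction T using Finset.induction_on with
  | empty =>
    intro τ hτ R hR
    refine Summable.of_nonneg_of_le (fun n => by positivity) (fun n => ?_)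
      (summable_geometric_of_lt_one (by positivity : 0 ≤ 2 * t) ht2)
    rw [mul_pow]
    gcongr
    exact_mod_cast QQ_empty_le F hF α hord hdisj τ hτ n R hR
  | insert C0 T hC0 ih =>
    have h0 : C0 ∈ α := hT (Finset.mem_insert_self _ _)
    have ih := ih (fun C hC => hT (Finset.mem_insert_of_mem hC))
    have hFC : (F '' C0).OrdConnected := ordConnected_image hF (hord C0 h0)
    intro τ hτ R hR
    have hG : Summable fun n => (QQ F α (insert C0 T) (tau C0) n (F '' C0) : ℝ) * t ^ n := by
      refine Summable.of_nonneg_of_le (fun n => by positivity) (fun n => ?_) (hloop C0 h0)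
      gcongr
      exact QQ_mono F α _ _ hT _ _ _
    have hZ : Summable fun n => (QQ F α (insert C0 T) τ n (F '' C0) : ℝ) * t ^ n := by
      have := (ih τ hτ _ hFC).add (summable_conv ht _ _ hG (ih τ hτ _ hFC))
      refine this.congr fun n => ?_
      rw [QQ_last F α T C0 h0 hC0 (hne C0 h0) τ n]
      push_cast
      ring
    have := (ih τ hτ _ hR).add (summable_conv ht _ _ (ih (tau C0) (htau C0) _ hR) hZ)
    refine this.congr fun n => ?_
    rw [QQ_first F α T C0 h0 hC0 (hne C0 h0) τ n]
    push_cast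
    ring


lemma ordConnected_pull {F : ℝ → ℝ} {C E : Set ℝ} (hC : C.OrdConnected) (hE : E.OrdConnected)
    (hmon : MonotoneOn F C ∨ AntitoneOn F C) : (C ∩ F ⁻¹' E).OrdConnected := by
  constructor
  rintro x ⟨hx, hx'⟩ y ⟨hy, hy'⟩ z ⟨hz1, hz2⟩
  have hz : z ∈ C := hC.out hx hy ⟨hz1, hz2⟩
  refine ⟨hz, ?_⟩
  rcases hmon with h | h
  · exact hE.out hx' hy' ⟨h hx hz hz1, h hz hy hz2⟩
  · exact hE.out hy' hx' ⟨h hz hy hz2, h hx hz hz1⟩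

/-- Extraction of disjoint intervals with full image. -/
lemma QQ_family (F : ℝ → ℝ) (hF : Continuous F) (α : Finset (Set ℝ))
    (hord : ∀ C ∈ α, C.OrdConnected)
    (hdisj : ∀ C ∈ α, ∀ D ∈ α, C ≠ D → Disjoint C D)
    (hmon : ∀ C ∈ α, MonotoneOn F C ∨ AntitoneOn F C) (B : Set ℝ) (n : ℕ) :
    ∀ R : Set ℝ, R.OrdConnected → ∃ (ι : Type) (_ : Fintype ι) (E : ι → Set ℝ),
      Fintype.card ι = QQ F α α (tau B) n R ∧ (∀ i, (E i).OrdConnected ∧ E i ⊆ R) ∧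
      (∀ i j, i ≠ j → Disjoint (E i) (E j)) ∧ ∀ i, B ⊆ F^[n] '' E i := by
  classical
  induction n with
  | zero =>
    intro R hR
    by_cases hB : B ⊆ R
    · refine ⟨Unit, inferInstance, fun _ => R, ?_, ?_, ?_, ?_⟩
      · simp [QQ, tau, hB]
      · exact fun _ => ⟨hR, le_rfl⟩
      · intro i j h; exact absurd (Subsingleton.elim i j) h
      · simpa using hB
    · refine ⟨Empty, inferInstance, fun _ => R, ?_, ?_, ?_, ?_⟩
      · simp [QQ, tau, hB]
      · exact fun _ => ⟨hR, le_rfl⟩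
      · intro i j h; exact absurd (Subsingleton.elim i j) h
      · exact fun i => i.elim
  | succ n ih =>
    intro R hR
    set S := α.filter (fun C => (R ∩ C).Nonempty ∧ (C ⊆ R → C ∈ α)) with hS
    have hSα : ∀ C : S, (C : Set ℝ) ∈ α := fun C => (Finset.mem_filter.1 C.2).1
    have key : ∀ C : S, _ := fun C => ih (F '' (R ∩ C))
      (ordConnected_image hF (hR.inter (hord C (hSα C))))
    choose ι fι E h1 h2 h3 h4 using key
    refine ⟨Σ C : S, ι C, inferInstance,
      fun p => R ∩ (p.1 ∩ F ⁻¹' (E p.1 p.2)), ?_, ?_, ?_, ?_⟩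
    · rw [Fintype.card_sigma]
      simp only [h1, QQ]
      rw [← hS]
      exact Finset.sum_coe_sort S (fun C => QQ F α α (tau B) n (F '' (R ∩ C)))
    · rintro ⟨C, i⟩
      exact ⟨hR.inter (ordConnected_pull (hord C (hSα C)) (h2 C i).1 (hmon C (hSα C))),
        inter_subset_left⟩
    · rintro ⟨C, i⟩ ⟨D, j⟩ hne
      by_cases hCD : C = D
      · subst hCD
        have hij : i ≠ j := by rintro rfl; exact hne rfl
        have := h3 C i j hij
        rw [Set.disjoint_left] at this ⊢
        rintro x ⟨_, _, hx⟩ ⟨_, _, hx'⟩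
        exact this hx hx'
      · have := hdisj C (hSα C) D (hSα D) (fun h => hCD (Subtype.ext h))
        rw [Set.disjoint_left] at this ⊢
        rintro x ⟨_, hx, _⟩ ⟨_, hx', _⟩
        exact this hx hx'
    · rintro ⟨C, i⟩ b hb
      obtain ⟨z, hz, rfl⟩ := h4 C i hb
      obtain ⟨x, ⟨hxR, hxC⟩, rfl⟩ := (h2 C i).2 hz
      exact ⟨x, ⟨hxR, hxC, hz⟩, rfl⟩

/-- The cell of the word `w`. -/
def cell (f : ℝ → ℝ) (I : Set ℝ) (m : ℕ) (w : Finset ℕ) : Set ℝ := {x | x ∈ I ∧ wd f m x = w}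

lemma wd_le {f : ℝ → ℝ} {m n : ℕ} (h : m ≤ n) {x y : ℝ} (hw : wd f n x = wd f n y) :
    wd f m x = wd f m y := by
  ext i
  have := Finset.ext_iff.1 hw i
  simp only [mem_wd] at this ⊢
  constructor
  · rintro ⟨h1, h2⟩; exact ⟨h1, (this.1 ⟨by omega, h2⟩).2⟩
  · rintro ⟨h1, h2⟩; exact ⟨h1, (this.2 ⟨by omega, h2⟩).2⟩

lemma wd_between {f : ℝ → ℝ} (hmono : MonotoneOn f (Iic 0)) (hanti : AntitoneOn f (Ici 0))
    (m : ℕ) {x y z : ℝ} (hxz : x ≤ z) (hzy : z ≤ y) (hw : wd f m x = wd f m y) :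
    wd f m z = wd f m x := by
  induction m with
  | zero => simp [wd]
  | succ m ih =>
    have e1 := ih (wd_le (Nat.le_succ m) hw)
    have e2 : wd f m z = wd f m y := e1.trans (wd_le (Nat.le_succ m) hw)
    have hm := Finset.ext_iff.1 hw m
    simp only [mem_wd] at hm
    have key : f^[m] z < 0 ↔ f^[m] x < 0 := by
      have a1 := sg_mono hmono hanti hxz e1.symm m le_rfl
      have a2 := sg_mono hmono hanti hzy e2 m le_rfl
      rw [e1] at a2
      have hm' : f^[m] x < 0 ↔ f^[m] y < 0 := by simpa using hm
      rcases a1 with ⟨s1, a1⟩ | ⟨s1, a1⟩ <;> rcases a2 with ⟨s2, a2⟩ | ⟨s2, a2⟩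
      · exact ⟨fun h => lt_of_le_of_lt a1 h, fun h => lt_of_le_of_lt a2 (hm'.1 h)⟩
      · rw [s1] at s2; norm_num at s2
      · rw [s1] at s2; norm_num at s2
      · exact ⟨fun h => hm'.2 (lt_of_le_of_lt a2 h), fun h => lt_of_le_of_lt a1 h⟩
    ext i
    have e := Finset.ext_iff.1 e1 i
    simp only [mem_wd] at e ⊢
    by_cases hi : i < m
    · simp only [hi, true_and] at e
      rw [e]
    · by_cases hi' : i = m
      · subst hi'; rw [key]
      · have : ¬ i < m + 1 := by omega
        simp [this]

lemma cell_ord {f : ℝ → ℝ} (hmono : MonotoneOn f (Iic 0)) (hanti : AntitoneOn f (Ici 0))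
    {I : Set ℝ} (hI : I.OrdConnected) (m : ℕ) (w : Finset ℕ) : (cell f I m w).OrdConnected := by
  constructor
  rintro x ⟨hx, hx'⟩ y ⟨hy, hy'⟩ z ⟨hz1, hz2⟩
  exact ⟨hI.out hx hy ⟨hz1, hz2⟩, (wd_between hmono hanti m hz1 hz2 (hx'.trans hy'.symm)).trans hx'⟩

lemma cell_mon {f : ℝ → ℝ} (hmono : MonotoneOn f (Iic 0)) (hanti : AntitoneOn f (Ici 0))
    {I : Set ℝ} (m : ℕ) (w : Finset ℕ) :
    MonotoneOn f^[m] (cell f I m w) ∨ AntitoneOn f^[m] (cell f I m w) := by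
  rcases sg_cases w m with h | h
  · left
    rintro x ⟨hx, hx'⟩ y ⟨hy, hy'⟩ hxy
    rcases sg_mono hmono hanti hxy (hx'.trans hy'.symm) m le_rfl with h1 | h1
    · exact h1.2
    · rw [hx', h] at h1; norm_num at h1
  · right
    rintro x ⟨hx, hx'⟩ y ⟨hy, hy'⟩ hxy
    rcases sg_mono hmono hanti hxy (hx'.trans hy'.symm) m le_rfl with h1 | h1
    · rw [hx', h] at h1; norm_num at h1
    · exact h1.2

open Classical in
/-- The partition into cells. -/
noncomputable def cells (f : ℝ → ℝ) (I : Set ℝ) (m : ℕ) : Finset (Set ℝ) :=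
  ((wd_finite f m I).toFinset).image (cell f I m)

lemma mem_cells {f : ℝ → ℝ} {I : Set ℝ} {m : ℕ} {C : Set ℝ} :
    C ∈ cells f I m ↔ ∃ x ∈ I, cell f I m (wd f m x) = C := by
  simp [cells]

lemma words_le_QQ {f : ℝ → ℝ} {I : Set ℝ} (hI : MapsTo f I I) (m n : ℕ) :
    ∀ R ⊆ I, (wd f (m * n) '' R).ncard ≤
      QQ f^[m] (cells f I m) (cells f I m) (fun _ => 1) n R := by
  classical
  induction n with
  | zero =>
    intro R _
    simpa [QQ] using wd_ncard_le f 0 R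
  | succ n ih =>
    intro R hR
    simp only [QQ]
    set S := (cells f I m).filter (fun C => (R ∩ C).Nonempty ∧ (C ⊆ R → C ∈ cells f I m)) with hS
    have hsub : wd f (m * (n + 1)) '' R ⊆ ⋃ C ∈ S, wd f (m * (n + 1)) '' (R ∩ C) := by
      rintro _ ⟨x, hx, rfl⟩
      simp only [mem_iUnion]
      have hc : cell f I m (wd f m x) ∈ cells f I m := mem_cells.2 ⟨x, hR hx, rfl⟩
      have hxc : x ∈ R ∩ cell f I m (wd f m x) := ⟨hx, hR hx, rfl⟩
      exact ⟨_, Finset.mem_filter.2 ⟨hc, ⟨x, hxc⟩, fun _ => hc⟩, x, hxc, rfl⟩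
    have hle : ∀ C ∈ S, (wd f (m * (n + 1)) '' (R ∩ C)).ncard ≤
        QQ f^[m] (cells f I m) (cells f I m) (fun _ => 1) n (f^[m] '' (R ∩ C)) := by
      intro C hC
      obtain ⟨x0, hx0, rfl⟩ := mem_cells.1 (Finset.mem_filter.1 hC).1
      refine le_trans ?_ (ih (f^[m] '' (R ∩ cell f I m (wd f m x0))) ?_)
      · have : wd f (m * (n + 1)) '' (R ∩ cell f I m (wd f m x0)) ⊆
            (fun u : Finset ℕ => wd f m x0 ∪ u.image (· + m)) ''
              (wd f (m * n) '' (f^[m] '' (R ∩ cell f I m (wd f m x0)))) := by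
          rintro _ ⟨x, ⟨hx, hx', hx''⟩, rfl⟩
          refine ⟨_, ⟨_, ⟨x, ⟨hx, hx', hx''⟩, rfl⟩, rfl⟩, ?_⟩
          rw [mul_add, mul_one, add_comm (m * n) m, wd_add, hx'']
        exact (Set.ncard_le_ncard this ((wd_finite _ _ _).image _)).trans
          (Set.ncard_image_le (wd_finite _ _ _))
      · rintro _ ⟨x, ⟨hx, _⟩, rfl⟩
        exact hI.iterate m (hR hx)
    refine (Set.ncard_le_ncard hsub ?_).trans ?_
    · exact S.finite_toSet.biUnion fun C _ => wd_finite _ _ _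
    · refine (Finset.set_ncard_biUnion_le S _).trans (Finset.sum_le_sum hle)

lemma Av_empty (f : ℝ → ℝ) (I : Set ℝ) (n : ℕ) : Av f ∅ I n = I := by
  ext x; simp [Av]

lemma exists_big_loop {f : ℝ → ℝ} (hf : Continuous f) (hmono : MonotoneOn f (Iic 0))
    (hanti : AntitoneOn f (Ici 0)) {I : Set ℝ} (hI : MapsTo f I I) (hIo : I.OrdConnected)
    {s σ : ℝ} (hσ : 1 < σ) (hs : σ < s) (hw : ∀ j, s ^ j ≤ (vc f ∅ I j : ℝ)) :
    ∃ m, 1 ≤ m ∧ ∃ C ∈ cells f I m, ∃ n,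
      σ ^ (m * (n + 1)) + 2 < (QQ f^[m] (cells f I m) (cells f I m) (tau C) n (f^[m] '' C) : ℝ) := by
  have hs1 : 1 < s := hσ.trans hs
  obtain ⟨m, hm⟩ := pow_unbounded_of_one_lt 2 hs1
  have hm1 : 1 ≤ m := by
    rcases Nat.eq_zero_or_pos m with rfl | h
    · norm_num at hm
    · exact h
  refine ⟨m, hm1, ?_⟩
  by_contra! hcon
  set t : ℝ := (s ^ m)⁻¹ with ht
  have hsm : 0 < s ^ m := by positivity
  have ht0 : 0 < t := inv_pos.2 hsm
  have ht2 : 2 * t < 1 := by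
    rw [ht, mul_inv_lt_iff₀ hsm]; linarith
  have hσt : σ ^ m * t < 1 := by
    rw [ht, mul_inv_lt_iff₀ hsm, one_mul]
    exact pow_lt_pow_left₀ hs (by linarith) (by omega)
  have hsum := QQ_summable f^[m] (hf.iterate m) (cells f I m)
    (fun C hC => by
      obtain ⟨x, _, rfl⟩ := mem_cells.1 hC
      exact cell_ord hmono hanti hIo m _)
    (fun C hC => by
      obtain ⟨x, hx, rfl⟩ := mem_cells.1 hC
      exact ⟨x, hx, rfl⟩)
    (fun C hC D hD hne => by
      obtain ⟨x, hx, rfl⟩ := mem_cells.1 hC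
      obtain ⟨y, hy, rfl⟩ := mem_cells.1 hD
      rw [Set.disjoint_left]
      rintro z ⟨hz, hz1⟩ ⟨_, hz2⟩
      exact hne (by rw [← hz1, ← hz2]))
    t ht0.le ht2
    (fun C hC => by
      have h1 : Summable fun n : ℕ => σ ^ m * (σ ^ m * t) ^ n + 2 * t ^ n :=
        ((summable_geometric_of_lt_one (by positivity) hσt).mul_left _).add
          ((summable_geometric_of_lt_one ht0.le (by linarith)).mul_left _)
      refine Summable.of_nonneg_of_le (fun n => by positivity) (fun n => ?_) h1
      have := hcon C hC n
      calc _ ≤ (σ ^ (m * (n + 1)) + 2) * t ^ n := by gcongr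
        _ = _ := by rw [pow_mul, pow_succ, mul_pow]; ring)
    (cells f I m) le_rfl (fun _ => 1) (fun _ => le_rfl) I hIo
  have h0 := hsum.tendsto_atTop_zero
  have h1 := (h0.eventually (gt_mem_nhds (zero_lt_one (α := ℝ)))).exists
  obtain ⟨n, hn⟩ := h1
  have h2 := words_le_QQ hI m n I le_rfl
  have h3 := hw (m * n)
  rw [vc, Av_empty] at h3
  have h4 : s ^ (m * n) ≤
    (QQ f^[m] (cells f I m) (cells f I m) (fun _ => 1) n I : ℝ) := h3.trans (by exact_mod_cast h2)
  have h5 : s ^ (m * n) * t ^ n = 1 := by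
    rw [ht, pow_mul, ← mul_pow, mul_inv_cancel₀ hsm.ne', one_pow]
  have h6 : s ^ (m * n) * t ^ n ≤
    (QQ f^[m] (cells f I m) (cells f I m) (fun _ => 1) n I : ℝ) * t ^ n := by gcongr
  linarith

/-- Existence of a strict horseshoe. -/
lemma exists_horseshoe {f : ℝ → ℝ} (hf : Continuous f) (hmono : MonotoneOn f (Iic 0))
    (hanti : AntitoneOn f (Ici 0)) {I : Set ℝ} (hI : MapsTo f I I) (hIo : I.OrdConnected)
    {s σ : ℝ} (hσ : 1 < σ) (hs : σ < s) (hw : ∀ j, s ^ j ≤ (vc f ∅ I j : ℝ)) :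
    ∃ M, 1 ≤ M ∧ ∃ (ι : Type) (_ : Fintype ι) (x y : ι → ℝ), σ ^ M ≤ (Fintype.card ι : ℝ) ∧
      (∀ i, x i ∈ I ∧ y i ∈ I) ∧
      (∀ i j, i ≠ j → Disjoint (uIcc (x i) (y i)) (uIcc (x j) (y j))) ∧
      ∀ i j, f^[M] (x i) < x j ∧ f^[M] (x i) < y j ∧ x j < f^[M] (y i) ∧ y j < f^[M] (y i) := by
  classical
  obtain ⟨m, hm, C, hC, n, hn⟩ := exists_big_loop hf hmono hanti hI hIo hσ hs hw
  have hord : ∀ C ∈ cells f I m, C.OrdConnected := fun C hC => by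
      obtain ⟨x, _, rfl⟩ := mem_cells.1 hC
      exact cell_ord hmono hanti hIo m _
  have hmon : ∀ C ∈ cells f I m, MonotoneOn f^[m] C ∨ AntitoneOn f^[m] C := fun C hC => by
      obtain ⟨x, _, rfl⟩ := mem_cells.1 hC
      exact cell_mon hmono hanti m _
  obtain ⟨ι, fι, E, h1, h2, h3, h4⟩ := QQ_family f^[m] (hf.iterate m) (cells f I m) hord
    (fun C hC D hD hne => by
      obtain ⟨x, hx, rfl⟩ := mem_cells.1 hC
      obtain ⟨y, hy, rfl⟩ := mem_cells.1 hD
      rw [Set.disjoint_left]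
      rintro z ⟨hz, hz1⟩ ⟨_, hz2⟩
      exact hne (by rw [← hz1, ← hz2])) hmon C n (f^[m] '' C)
    (ordConnected_image (hf.iterate m) (hord C hC))
  have hCI : C ⊆ I := by
    obtain ⟨x, hx, rfl⟩ := mem_cells.1 hC
    exact fun z hz => hz.1
  have hCne : C.Nonempty := by
    obtain ⟨x, hx, rfl⟩ := mem_cells.1 hC
    exact ⟨x, hx, rfl⟩
  set M := m * (n + 1) with hM
  rw [← h1] at hn
  set E' : ι → Set ℝ := fun i => C ∩ f^[m] ⁻¹' (E i) with hE'
  have hE'o : ∀ i, (E' i).OrdConnected := fun i =>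
    ordConnected_pull (hord C hC) (h2 i).1 (hmon C hC)
  have hE'd : ∀ i j, i ≠ j → ∀ z, z ∈ E' i → z ∉ E' j := fun i j hij z hz hz' =>
    Set.disjoint_left.1 (h3 i j hij) hz.2 hz'.2
  have hE'c : ∀ i, ∀ b ∈ C, ∃ z ∈ E' i, f^[M] z = b := by
    intro i b hb
    obtain ⟨w, hw, rfl⟩ := h4 i hb
    obtain ⟨z, hz, rfl⟩ := (h2 i).2 hw
    refine ⟨z, ⟨hz, hw⟩, ?_⟩
    rw [hM, Function.iterate_mul, Function.iterate_succ_apply]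
  choose e he _ using fun i => hE'c i _ hCne.some_mem
  have hσM : 1 ≤ σ ^ M := one_le_pow₀ hσ.le
  have hcard : 3 < (Fintype.card ι : ℝ) := by linarith
  have hcard' : 3 < Fintype.card ι := by exact_mod_cast hcard
  have : Nonempty ι := Fintype.card_pos_iff.1 (by omega)
  obtain ⟨imin, himin⟩ := Finite.exists_min e
  obtain ⟨imax, himax⟩ := Finite.exists_max e
  choose x hx hxu using fun i => hE'c i (e imin) (he imin).1
  choose y hy hyv using fun i => hE'c i (e imax) (he imax).1
  have low : ∀ j, j ≠ imin → ∀ z ∈ E' j, e imin < z := by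
    intro j hj z hz
    by_contra! hle
    exact hE'd _ _ hj.symm _ (he imin) ((hE'o j).out hz (he j) ⟨hle, himin j⟩)
  have high : ∀ j, j ≠ imax → ∀ z ∈ E' j, z < e imax := by
    intro j hj z hz
    by_contra! hle
    exact hE'd _ _ hj.symm _ (he imax) ((hE'o j).out (he j) hz ⟨himax j, hle⟩)
  refine ⟨M, Nat.mul_pos hm (Nat.succ_pos n), {i : ι // i ∉ ({imin, imax} : Finset ι)},
    inferInstance, fun i => x i, fun i => y i, ?_, ?_, ?_, ?_⟩
  · have : Fintype.card {i : ι // i ∉ ({imin, imax} : Finset ι)} =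
        Fintype.card ι - ({imin, imax} : Finset ι).card := by
      rw [Fintype.card_subtype_compl, Fintype.card_coe]
    have h2c : ({imin, imax} : Finset ι).card ≤ 2 := Finset.card_le_two
    have : Fintype.card ι ≤ Fintype.card {i : ι // i ∉ ({imin, imax} : Finset ι)} + 2 := by omega
    have : (Fintype.card ι : ℝ) ≤
      Fintype.card {i : ι // i ∉ ({imin, imax} : Finset ι)} + 2 := by exact_mod_cast this
    linarith
  · exact fun i => ⟨hCI (hx i).1, hCI (hy i).1⟩
  · intro i j hij
    rw [Set.disjoint_left]
    intro z hz hz'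
    have hij' : (i : ι) ≠ j := fun h => hij (Subtype.ext h)
    exact hE'd i j hij' z ((hE'o i).uIcc_subset (hx i) (hy i) hz)
      ((hE'o j).uIcc_subset (hx j) (hy j) hz')
  · intro i j
    have hj := j.2
    simp only [Finset.mem_insert, Finset.mem_singleton, not_or] at hj
    rw [hxu, hyv]
    exact ⟨low _ hj.1 _ (hx j), low _ hj.1 _ (hy j), high _ hj.2 _ (hx j), high _ hj.2 _ (hy j)⟩

lemma chain {f : ℝ → ℝ} {ι : Type} (L : ι → Set ℝ) (M : ℕ) (hne : ∀ i, (L i).Nonempty)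
    (hcov : ∀ i j, L j ⊆ f^[M] '' L i) (q : ℕ) :
    ∀ s : ℕ → ι, ∃ p ∈ L (s 0), ∀ j ≤ q, f^[M * j] p ∈ L (s j) := by
  induction q with
  | zero =>
    intro s
    obtain ⟨p, hp⟩ := hne (s 0)
    refine ⟨p, hp, fun j hj => ?_⟩
    obtain rfl : j = 0 := by omega
    simpa using hp
  | succ q ih =>
    intro s
    obtain ⟨p', hp', h⟩ := ih (fun j => s (j + 1))
    obtain ⟨p, hp, rfl⟩ := hcov (s 0) (s 1) hp'
    refine ⟨p, hp, fun j hj => ?_⟩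
    rcases j with _ | j
    · simpa using hp
    · have := h j (by omega)
      rwa [← Function.iterate_add_apply] at this

lemma exists_sep {ι : Type} [Fintype ι] [Nonempty ι] (L : ι → Set ℝ) (hc : ∀ i, IsCompact (L i))
    (hd : ∀ i j, i ≠ j → Disjoint (L i) (L j)) :
    ∃ δ > 0, ∀ i j, i ≠ j → ∀ u ∈ L i, ∀ v ∈ L j, δ ≤ |u - v| := by
  have h1 : ∀ p : ι × ι, ∃ δ : ℝ, 0 < δ ∧ (p.1 ≠ p.2 → ∀ u ∈ L p.1, ∀ v ∈ L p.2, δ ≤ |u - v|) := by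
    rintro ⟨i, j⟩
    by_cases hij : i = j
    · exact ⟨1, one_pos, fun h => absurd hij h⟩
    · obtain ⟨ρ, hρ, h⟩ := Metric.exists_pos_forall_lt_edist (hc i) (hc j).isClosed (hd i j hij)
      refine ⟨ρ, by exact_mod_cast hρ, fun _ u hu v hv => ?_⟩
      have := h u hu v hv
      rw [edist_nndist] at this
      have h2 : ρ < nndist u v := by exact_mod_cast this
      rw [← Real.dist_eq, ← coe_nndist]
      exact_mod_cast h2.le
  choose δ hδ h using h1
  obtain ⟨p, hp⟩ := Finite.exists_min δ
  exact ⟨δ p, hδ p, fun i j hij u hu v hv => (hp (i, j)).trans (h (i, j) hij u hu v hv)⟩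

lemma le_entropy_horseshoe {f : ℝ → ℝ} {I : Set ℝ} {ι : Type} [Fintype ι] (L : ι → Set ℝ) (M : ℕ)
    (hM : 1 ≤ M) (hc : ∀ i, IsCompact (L i)) (hd : ∀ i j, i ≠ j → Disjoint (L i) (L j))
    (hne : ∀ i, (L i).Nonempty) (hLI : ∀ i, L i ⊆ I)
    (hcov : ∀ i j, L j ⊆ f^[M] '' L i) (y : ℝ) (hy : Real.exp (y * M) ≤ Fintype.card ι) :
    (y : EReal) ≤ Dynamics.coverEntropy f I := by
  classical
  have hcard : 0 < Fintype.card ι := by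
    have : (0 : ℝ) < Fintype.card ι := lt_of_lt_of_le (Real.exp_pos _) hy
    exact_mod_cast this
  have : Nonempty ι := Fintype.card_pos_iff.1 hcard
  obtain ⟨δ, hδ, hsep⟩ := exists_sep L hc hd
  refine le_entropy f I y δ hδ M (Fintype.card ι) hM hy fun q => ?_
  choose p hp0 hp using chain L M hne hcov q
  let ext : (Fin q → ι) → ℕ → ι := fun s j => if h : j < q then s ⟨j, h⟩ else Classical.arbitrary ι
  have hsep' : ∀ s s' : Fin q → ι, s ≠ s' →
      ∃ j < M * q, δ ≤ |f^[j] (p (ext s)) - f^[j] (p (ext s'))| := by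
    intro s s' hne
    obtain ⟨⟨j, hj⟩, hj'⟩ := Function.ne_iff.1 hne
    refine ⟨M * j, Nat.mul_lt_mul_of_pos_left hj hM, ?_⟩
    have e1 : ext s j = s ⟨j, hj⟩ := by simp [ext, hj]
    have e2 : ext s' j = s' ⟨j, hj⟩ := by simp [ext, hj]
    refine hsep (s ⟨j, hj⟩) (s' ⟨j, hj⟩) hj' _ ?_ _ ?_
    · rw [← e1]; exact hp _ j hj.le
    · rw [← e2]; exact hp _ j hj.le
  have hinj : Function.Injective (fun s => p (ext s)) := by
    intro s s' h
    by_contra hne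
    obtain ⟨j, _, hj⟩ := hsep' s s' hne
    have h' : p (ext s) = p (ext s') := h
    rw [h'] at hj
    simp at hj
    linarith
  refine ⟨Finset.univ.image (fun s => p (ext s)), ?_, ?_, ?_⟩
  · intro z hz
    simp only [Finset.coe_image, Finset.coe_univ, image_univ, mem_range] at hz
    obtain ⟨s, rfl⟩ := hz
    exact hLI _ (hp0 _)
  · rw [Finset.card_image_of_injective _ hinj]
    simp
  · intro x hx z hz hxz
    simp only [Finset.mem_image, Finset.mem_univ, true_and] at hx hz
    obtain ⟨s, rfl⟩ := hx
    obtain ⟨s', rfl⟩ := hz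
    exact hsep' s s' (fun h => hxz (by rw [h]))

lemma plm_cont2 {r : ℝ} (hr : 1 < r) : Continuous fun p : ℝ × ℝ => powerLawMap p.1 r p.2 := by
  unfold powerLawMap
  exact continuous_fst.sub ((continuous_snd.abs).rpow_const fun _ => Or.inr (by linarith))

lemma plm_iter_cont2 {r : ℝ} (hr : 1 < r) (n : ℕ) :
    Continuous fun p : ℝ × ℝ => (powerLawMap p.1 r)^[n] p.2 := by
  induction n with
  | zero => simpa using continuous_snd
  | succ n ih =>
    simp only [Function.iterate_succ_apply']
    exact (plm_cont2 hr).comp (continuous_fst.prodMk ih)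

lemma plm_cont {r : ℝ} (hr : 1 < r) (a : ℝ) : Continuous (powerLawMap a r) :=
  (plm_cont2 hr).comp (Continuous.prodMk_right a)

lemma plm_mono {r : ℝ} (hr : 1 < r) (a : ℝ) : MonotoneOn (powerLawMap a r) (Iic 0) := by
  intro x hx y hy hxy
  simp only [mem_Iic] at hx hy
  unfold powerLawMap
  have : |y| ^ r ≤ |x| ^ r := by
    apply Real.rpow_le_rpow (abs_nonneg _) _ (by linarith)
    rw [abs_of_nonpos hx, abs_of_nonpos hy]; linarith
  linarith

lemma plm_anti {r : ℝ} (hr : 1 < r) (a : ℝ) : AntitoneOn (powerLawMap a r) (Ici 0) := by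
  intro x hx y hy hxy
  simp only [mem_Ici] at hx hy
  unfold powerLawMap
  have : |x| ^ r ≤ |y| ^ r := by
    apply Real.rpow_le_rpow (abs_nonneg _) _ (by linarith)
    rw [abs_of_nonneg hx, abs_of_nonneg hy]; linarith
  linarith

lemma lsc_words {r : ℝ} (hr : 1 < r) {I : Set ℝ} (hIo : I.OrdConnected) {a₀ : ℝ}
    (h₀ : MapsTo (powerLawMap a₀ r) I I) {y s : ℝ} (hy : 0 < y) (hys : y < s)
    (hw : ∀ j : ℕ, Real.exp (s * j) ≤ (vc (powerLawMap a₀ r) ∅ I j : ℝ)) :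
    ∀ᶠ a in 𝓝 a₀, (y : EReal) ≤ Dynamics.coverEntropy (powerLawMap a r) I := by
  obtain ⟨M, hM, ι, fι, x, z, hcard, hxz, hd, hst⟩ := exists_horseshoe (plm_cont hr a₀)
    (plm_mono hr a₀) (plm_anti hr a₀) h₀ hIo (s := Real.exp s) (σ := Real.exp y)
    (by simpa using hy) (by simpa using hys)
    (fun j => by rw [← Real.exp_nat_mul, mul_comm]; exact hw j)
  have hev : ∀ᶠ a in 𝓝 a₀, ∀ i j, (powerLawMap a r)^[M] (x i) < x j ∧
      (powerLawMap a r)^[M] (x i) < z j ∧ x j < (powerLawMap a r)^[M] (z i) ∧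
      z j < (powerLawMap a r)^[M] (z i) := by
    have hc : ∀ u : ℝ, Continuous fun a => (powerLawMap a r)^[M] u := fun u =>
      (plm_iter_cont2 hr M).comp (Continuous.prodMk_left u)
    rw [eventually_all]
    intro i
    rw [eventually_all]
    intro j
    obtain ⟨q1, q2, q3, q4⟩ := hst i j
    exact (((hc _).continuousAt.eventually_lt continuousAt_const q1)).and
      ((((hc _).continuousAt.eventually_lt continuousAt_const q2)).and
      (((continuousAt_const.eventually_lt (hc _).continuousAt q3)).and
      ((continuousAt_const.eventually_lt (hc _).continuousAt q4))))
  filter_upwards [hev] with a ha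
  refine le_entropy_horseshoe (fun i => uIcc (x i) (z i)) M hM (fun i => isCompact_uIcc) hd
    (fun i => nonempty_uIcc) (fun i => hIo.uIcc_subset (hxz i).1 (hxz i).2) ?_ y ?_
  · intro i j
    refine subset_trans ?_ (intermediate_value_uIcc ((plm_cont hr a).iterate M).continuousOn)
    obtain ⟨q1, q2, q3, q4⟩ := ha i j
    rw [uIcc_of_le (q1.trans q3).le]
    intro w hw
    rw [mem_uIcc] at hw
    rcases hw with ⟨u1, u2⟩ | ⟨u1, u2⟩ <;> constructor <;> linarith
  · rw [← Real.exp_nat_mul] at hcard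
    rwa [mul_comm]

lemma lsc_at {r : ℝ} (hr : 1 < r) {c d : ℝ} (hcd : c ≤ d) {a₀ : ℝ}
    (h₀ : MapsTo (powerLawMap a₀ r) (Icc c d) (Icc c d)) {y : EReal}
    (hy : y < Dynamics.coverEntropy (powerLawMap a₀ r) (Icc c d)) :
    ∀ᶠ a in 𝓝 a₀, y < Dynamics.coverEntropy (powerLawMap a r) (Icc c d) := by
  by_cases hy0 : y < 0
  · refine Eventually.of_forall fun a => lt_of_lt_of_le hy0 ?_
    exact Dynamics.coverEntropy_nonneg _ (nonempty_Icc.2 hcd)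
  · push Not at hy0
    obtain ⟨y1, h1, h2⟩ := EReal.lt_iff_exists_real_btwn.1 hy
    obtain ⟨y2, h3, h4⟩ := EReal.lt_iff_exists_real_btwn.1 h2
    have hy1 : 0 < y1 := by exact_mod_cast lt_of_le_of_lt hy0 h1
    have hy2 : y1 < y2 := by exact_mod_cast h3
    refine (lsc_words hr ordConnected_Icc h₀ hy1 hy2 fun j => ?_).mono fun a ha => h1.trans_le ha
    by_contra! hlt
    have hj : 1 ≤ j := by
      rcases Nat.eq_zero_or_pos j with rfl | h
      · exfalso
        simp only [CharP.cast_eq_zero, mul_zero, Real.exp_zero, vc, Av_empty] at hlt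
        have : (wd (powerLawMap a₀ r) 0 '' Icc c d).ncard < 1 := by exact_mod_cast hlt
        rw [Nat.lt_one_iff, Set.ncard_eq_zero (wd_finite _ _ _), image_eq_empty] at this
        exact (nonempty_Icc.2 hcd).ne_empty this
      · exact h
    have hv : 1 ≤ vc (powerLawMap a₀ r) ∅ (Icc c d) j := by
      rw [vc, Av_empty, Nat.one_le_iff_ne_zero, Ne, Set.ncard_eq_zero (wd_finite _ _ _),
        image_eq_empty]
      exact (nonempty_Icc.2 hcd).ne_empty
    have := entropy_le_words (plm_mono hr a₀) (plm_anti hr a₀) h₀ (C := max |c| |d|)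
      (fun x hx => abs_le_max_abs_abs hx.1 hx.2) ∅
      (fun ε _ => ⟨1, one_pos, fun x hx => absurd hx (notMem_empty x)⟩) j _ hj hv le_rfl y2 hlt
    exact absurd h4 (not_lt.2 this)

lemma pick_N {r : ℝ} (hr : 1 < r) {c d : ℝ} (hcd : c ≤ d) {a₀ : ℝ}
    (h₀ : MapsTo (powerLawMap a₀ r) (Icc c d) (Icc c d)) {y : EReal}
    (hy : Dynamics.coverEntropy (powerLawMap a₀ r) (Icc c d) < y) :
    ∃ y1 : ℝ, (y1 : EReal) < y ∧ ∃ N : ℕ, 1 ≤ N ∧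
      ((N + 1 : ℕ) * vc (powerLawMap a₀ r) ∅ (Icc c d) N : ℝ) < Real.exp (y1 * N) := by
  obtain ⟨y3, h1, h2⟩ := EReal.lt_iff_exists_real_btwn.1 hy
  obtain ⟨y2, h3, h4⟩ := EReal.lt_iff_exists_real_btwn.1 h1
  obtain ⟨y1, h5, h6⟩ := EReal.lt_iff_exists_real_btwn.1 h3
  have g1 : y1 < y2 := by exact_mod_cast h6
  have g2 : y2 < y3 := by exact_mod_cast h4
  have g0 : 0 < y1 := by
    have := lt_of_le_of_lt (Dynamics.coverEntropy_nonneg (powerLawMap a₀ r)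
      (nonempty_Icc.2 hcd)) h5
    exact_mod_cast this
  refine ⟨y3, h2, ?_⟩
  by_contra! hcon
  have hw : ∀ j : ℕ, Real.exp (y2 * j) ≤ (vc (powerLawMap a₀ r) ∅ (Icc c d) j : ℝ) := by
    intro j
    rcases Nat.eq_zero_or_pos j with rfl | hj
    · have hv : 1 ≤ vc (powerLawMap a₀ r) ∅ (Icc c d) 0 := by
        rw [vc, Av_empty, Nat.one_le_iff_ne_zero, Ne, Set.ncard_eq_zero (wd_finite _ _ _),
          image_eq_empty]
        exact (nonempty_Icc.2 hcd).ne_empty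
      simpa using hv
    · by_contra! hlt
      set θ := y3 - y2 with hθ
      have hθ0 : 0 < θ := by linarith
      obtain ⟨q, hq⟩ := exists_nat_gt (4 / θ ^ 2)
      have hq0 : 0 < (q : ℝ) := lt_of_le_of_lt (by positivity) hq
      have hq1 : 1 ≤ q := by exact_mod_cast hq0
      have hN : 1 ≤ j * q := Nat.mul_pos hj hq1
      have k1 := hcon (j * q) hN
      have k2 : (vc (powerLawMap a₀ r) ∅ (Icc c d) (j * q) : ℝ) ≤ Real.exp (y2 * (j * q : ℕ)) := by
        calc (vc (powerLawMap a₀ r) ∅ (Icc c d) (j * q) : ℝ)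
            ≤ (vc (powerLawMap a₀ r) ∅ (Icc c d) j : ℝ) ^ q := by
              exact_mod_cast vc_mul_le _ ∅ _ h₀ j q
          _ ≤ Real.exp (y2 * j) ^ q := by gcongr
          _ = _ := by rw [← Real.exp_nat_mul]; push_cast; congr 1; ring
      set n := j * q with hn
      have k3 : Real.exp (y3 * n) ≤ (n + 1 : ℕ) * Real.exp (y2 * n) :=
        k1.trans (by gcongr)
      have k4 : Real.exp (θ * n) ≤ n + 1 := by
        have : Real.exp (y3 * n) = Real.exp (θ * n) * Real.exp (y2 * n) := by
          rw [← Real.exp_add]; congr 1; rw [hθ]; ring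
        rw [this] at k3
        have := le_of_mul_le_mul_right k3 (Real.exp_pos _)
        exact_mod_cast this
      have k5 := Real.quadratic_le_exp_of_nonneg (x := θ * n) (by positivity)
      have k6 : (q : ℝ) ≤ n := by
        have : q ≤ n := by rw [hn]; exact Nat.le_mul_of_pos_left q hj
        exact_mod_cast this
      have k7 : 4 < θ ^ 2 * n := by
        rw [div_lt_iff₀ (by positivity)] at hq
        nlinarith [sq_nonneg θ]
      have hn0 : 0 < (n : ℝ) := lt_of_lt_of_le hq0 k6
      have k8 : 0 < θ * n := by positivity
      nlinarith
  have := (lsc_words hr ordConnected_Icc h₀ g0 g1 hw).self_of_nhds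
  exact absurd h5 (not_lt.2 this)

lemma tube {r : ℝ} (hr : 1 < r) (c d a₀ : ℝ) (N : ℕ) {η : ℝ} (hη : 0 < η) :
    ∀ᶠ a in 𝓝 a₀, ∀ x ∈ Icc c d, ∃ y ∈ Icc c d, ∀ i < N,
      ((powerLawMap a₀ r)^[i] y ≠ 0 →
        ((powerLawMap a r)^[i] x < 0 ↔ (powerLawMap a₀ r)^[i] y < 0)) ∧
      ((powerLawMap a₀ r)^[i] y = 0 → |(powerLawMap a r)^[i] x| < η) := by
  refine isCompact_Icc.eventually_forall_of_forall_eventually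
    (P := fun a x => ∃ y ∈ Icc c d, ∀ i < N,
      ((powerLawMap a₀ r)^[i] y ≠ 0 →
        ((powerLawMap a r)^[i] x < 0 ↔ (powerLawMap a₀ r)^[i] y < 0)) ∧
      ((powerLawMap a₀ r)^[i] y = 0 → |(powerLawMap a r)^[i] x| < η)) ?_
  intro y hy
  suffices h : ∀ᶠ z : ℝ × ℝ in 𝓝 (a₀, y), ∀ i ∈ Finset.range N,
      ((powerLawMap a₀ r)^[i] y ≠ 0 →
        ((powerLawMap z.1 r)^[i] z.2 < 0 ↔ (powerLawMap a₀ r)^[i] y < 0)) ∧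
      ((powerLawMap a₀ r)^[i] y = 0 → |(powerLawMap z.1 r)^[i] z.2| < η) by
    filter_upwards [h] with z hz
    exact ⟨y, hy, fun i hi => hz i (Finset.mem_range.2 hi)⟩
  rw [Filter.eventually_all_finset]
  intro i _
  have hc := (plm_iter_cont2 hr i).continuousAt (x := (a₀, y))
  rcases lt_trichotomy ((powerLawMap a₀ r)^[i] y) 0 with h | h | h
  · filter_upwards [hc.eventually_lt continuousAt_const h] with z hz
    exact ⟨fun _ => ⟨fun _ => h, fun _ => hz⟩, fun h' => absurd h' h.ne⟩
  · have : ContinuousAt (fun p : ℝ × ℝ => |(powerLawMap p.1 r)^[i] p.2|) (a₀, y) := hc.abs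
    filter_upwards [this.eventually_lt continuousAt_const
      (by simpa [h] using hη : |(powerLawMap (a₀, y).1 r)^[i] (a₀, y).2| < η)] with z hz
    exact ⟨fun h' => absurd h h', fun _ => hz⟩
  · filter_upwards [continuousAt_const.eventually_lt hc h] with z hz
    exact ⟨fun _ => ⟨fun h' => absurd h' (not_lt.2 hz.le), fun h' => absurd h' (not_lt.2 h.le)⟩,
      fun h' => absurd h' h.ne'⟩

lemma plm_lip {r : ℝ} (hr : 1 < r) (a : ℝ) {K x y : ℝ} (hx : |x| ≤ K) (hy : |y| ≤ K) :
    |powerLawMap a r x - powerLawMap a r y| ≤ r * K ^ (r - 1) * |x - y| := by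
  have h := (convex_Icc (0 : ℝ) K).norm_image_sub_le_of_norm_hasDerivWithin_le
    (f := fun t : ℝ => t ^ r) (f' := fun t => r * t ^ (r - 1)) (C := r * K ^ (r - 1))
    (fun t _ => (Real.hasDerivAt_rpow_const (Or.inr hr.le)).hasDerivWithinAt)
    (fun t ht => by
      have h0 : 0 ≤ t ^ (r - 1) := Real.rpow_nonneg ht.1 _
      rw [Real.norm_eq_abs, abs_of_nonneg (mul_nonneg (by linarith) h0)]
      exact mul_le_mul_of_nonneg_left (Real.rpow_le_rpow ht.1 ht.2 (by linarith)) (by linarith))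
    (x := |x|) (y := |y|) ⟨abs_nonneg _, hx⟩ ⟨abs_nonneg _, hy⟩
  simp only [Real.norm_eq_abs] at h
  have hK : 0 ≤ K := (abs_nonneg x).trans hx
  have e : powerLawMap a r x - powerLawMap a r y = |y| ^ r - |x| ^ r := by
    unfold powerLawMap; ring
  rw [e]
  refine h.trans ?_
  have : |(|y| - |x|)| ≤ |x - y| := by
    rw [abs_sub_comm x y]; exact abs_abs_sub_abs_le y x
  have h0 : 0 ≤ K ^ (r - 1) := Real.rpow_nonneg hK _
  gcongr

lemma iter_lip {f : ℝ → ℝ} {I : Set ℝ} (hI : MapsTo f I I) {L : ℝ} (hL : 0 ≤ L)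
    (h : ∀ x ∈ I, ∀ y ∈ I, |f x - f y| ≤ L * |x - y|) (n : ℕ) :
    ∀ x ∈ I, ∀ y ∈ I, |f^[n] x - f^[n] y| ≤ L ^ n * |x - y| := by
  induction n with
  | zero => intro x _ y _; simp
  | succ n ih =>
    intro x hx y hy
    simp only [Function.iterate_succ_apply]
    refine (ih _ (hI hx) _ (hI hy)).trans ?_
    rw [pow_succ, mul_assoc]
    exact mul_le_mul_of_nonneg_left (h x hx y hy) (by positivity)

/-- Equicontinuity near a superattracting periodic critical point. -/
lemma exists_trap {r : ℝ} (hr : 1 < r) {c d : ℝ} {a₀ : ℝ} (h0 : (0 : ℝ) ∈ Icc c d) {p : ℕ}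
    (hp : 1 ≤ p) (hper : (powerLawMap a₀ r)^[p] 0 = 0) :
    ∃ η > 0, ∀ᶠ a in 𝓝 a₀, MapsTo (powerLawMap a r) (Icc c d) (Icc c d) →
      ∀ ε > 0, ∃ δ > 0, ∀ x ∈ Icc c d ∩ Ioo (-η) η, ∀ y ∈ Icc c d ∩ Ioo (-η) η, |x - y| < δ →
        ∀ i, |(powerLawMap a r)^[i] x - (powerLawMap a r)^[i] y| < ε := by
  set C := max |c| |d| with hC
  have hC0 : 0 ≤ C := (abs_nonneg c).trans (le_max_left _ _)
  set L := max 1 (r * C ^ (r - 1)) with hL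
  have hL1 : 1 ≤ L := le_max_left _ _
  obtain ⟨η, hη, hη2⟩ : ∃ η > 0, L ^ (p - 1) * (r * η ^ (r - 1)) ≤ 1 / 2 := by
    have hc : ContinuousAt (fun η : ℝ => L ^ (p - 1) * (r * η ^ (r - 1))) 0 :=
      continuousAt_const.mul (continuousAt_const.mul
        (Real.continuousAt_rpow_const 0 (r - 1) (Or.inr (by linarith))))
    have hlt : (fun η : ℝ => L ^ (p - 1) * (r * η ^ (r - 1))) 0 < 1 / 2 := by
      simp [Real.zero_rpow (by linarith : r - 1 ≠ 0)]
    have h1 := hc.eventually_lt continuousAt_const hlt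
    have h2 := (h1.filter_mono nhdsWithin_le_nhds).and
      (self_mem_nhdsWithin : Ioi (0 : ℝ) ∈ 𝓝[>] 0)
    obtain ⟨η, h3, h4⟩ := h2.exists
    exact ⟨η, h4, h3.le⟩
  refine ⟨η, hη, ?_⟩
  have hcont : Continuous fun a => |(powerLawMap a r)^[p] 0| :=
    ((plm_iter_cont2 hr p).comp (Continuous.prodMk_left 0)).abs
  have hev := hcont.continuousAt.eventually_lt (continuousAt_const (y := η / 2))
    (by simpa [hper] using hη : |(powerLawMap a₀ r)^[p] 0| < η / 2)
  filter_upwards [hev] with a ha hI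
  set f := powerLawMap a r with hf
  set U := Icc c d ∩ Ioo (-η) η with hU
  have hlip : ∀ x ∈ Icc c d, ∀ y ∈ Icc c d, |f x - f y| ≤ L * |x - y| := by
    intro x hx y hy
    refine (plm_lip hr a (abs_le_max_abs_abs hx.1 hx.2) (abs_le_max_abs_abs hy.1 hy.2)).trans ?_
    gcongr
    exact le_max_right _ _
  have hlipn := iter_lip hI (by linarith) hlip
  have hcontr : ∀ x ∈ U, ∀ y ∈ U, |f^[p] x - f^[p] y| ≤ 1 / 2 * |x - y| := by
    intro x hx y hy
    have e1 : ∀ x, f^[p] x = f^[p - 1] (f x) := by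
      intro x; rw [← Function.iterate_succ_apply, Nat.succ_eq_add_one, Nat.sub_add_cancel hp]
    rw [e1, e1]
    refine (hlipn (p - 1) _ (hI hx.1) _ (hI hy.1)).trans ?_
    have h1 := plm_lip hr a (abs_lt.2 hx.2).le (abs_lt.2 hy.2).le
    calc L ^ (p - 1) * |f x - f y| ≤ L ^ (p - 1) * (r * η ^ (r - 1) * |x - y|) := by gcongr
      _ = L ^ (p - 1) * (r * η ^ (r - 1)) * |x - y| := by ring
      _ ≤ _ := by gcongr
  have h0U : (0 : ℝ) ∈ U := ⟨h0, by simpa using hη⟩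
  have hmaps : MapsTo f^[p] U U := by
    intro x hx
    refine ⟨hI.iterate p hx.1, abs_lt.1 ?_⟩
    have h1 := hcontr x hx 0 h0U
    have h2 : |x| < η := abs_lt.2 hx.2
    rw [sub_zero] at h1
    have h3 : |f^[p] x| ≤ |f^[p] x - f^[p] 0| + |f^[p] 0| := by
      simpa using abs_add_le (f^[p] x - f^[p] 0) (f^[p] 0)
    linarith
  have hk := iter_lip hmaps (by norm_num) hcontr
  intro ε hε
  have hLp : 0 < L ^ p := by positivity
  refine ⟨ε / L ^ p, by positivity, fun x hx y hy hxy i => ?_⟩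
  have hi : ∀ x, f^[i] x = f^[i % p] ((f^[p])^[i / p] x) := by
    intro x
    rw [← Function.iterate_mul, ← Function.iterate_add_apply, Nat.mod_add_div]
  rw [hi, hi]
  have m1 := hlipn (i % p) _ (hmaps.iterate (i / p) hx).1 _ (hmaps.iterate (i / p) hy).1
  have m2 := hk (i / p) x hx y hy
  have m3 : (1 / 2 : ℝ) ^ (i / p) ≤ 1 := pow_le_one₀ (by norm_num) (by norm_num)
  have m4 : L ^ (i % p) ≤ L ^ p := pow_le_pow_right₀ hL1 (Nat.mod_lt _ hp).le
  rw [lt_div_iff₀ hLp] at hxy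
  calc _ ≤ _ := m1
    _ ≤ L ^ p * (1 * |x - y|) := by
      gcongr
      exact m2.trans (by gcongr)
    _ < ε := by linarith

lemma usc_at {r : ℝ} (hr : 1 < r) {c d : ℝ} (hcd : c ≤ d) {a₀ : ℝ}
    (h₀ : MapsTo (powerLawMap a₀ r) (Icc c d) (Icc c d)) {y : EReal}
    (hy : Dynamics.coverEntropy (powerLawMap a₀ r) (Icc c d) < y) :
    ∀ᶠ a in 𝓝 a₀, MapsTo (powerLawMap a r) (Icc c d) (Icc c d) →
      Dynamics.coverEntropy (powerLawMap a r) (Icc c d) < y := by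
  classical
  obtain ⟨y1, hy1, N, hN, hlt⟩ := pick_N hr hcd h₀ hy
  set w := vc (powerLawMap a₀ r) ∅ (Icc c d) N with hw
  have hv : 1 ≤ w := by
    rw [hw, vc, Av_empty, Nat.one_le_iff_ne_zero, Ne, Set.ncard_eq_zero (wd_finite _ _ _),
      image_eq_empty]
    exact (nonempty_Icc.2 hcd).ne_empty
  have hB : 1 ≤ (N + 1) * w := Nat.mul_pos (Nat.succ_pos N) hv
  have hlt' : (((N + 1) * w : ℕ) : ℝ) < Real.exp (y1 * N) := by
    rw [Nat.cast_mul]; exact hlt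
  by_cases hper : (0 : ℝ) ∈ Icc c d ∧ ∃ p, 1 ≤ p ∧ (powerLawMap a₀ r)^[p] 0 = 0
  · obtain ⟨h0, p, hp, hpp⟩ := hper
    obtain ⟨η, hη, hev⟩ := exists_trap hr h0 hp hpp
    filter_upwards [hev, tube hr c d a₀ N hη] with a ha ht hI
    refine lt_of_le_of_lt (entropy_le_words (plm_mono hr a) (plm_anti hr a) hI (C := max |c| |d|)
      (fun x hx => abs_le_max_abs_abs hx.1 hx.2) (Icc c d ∩ Ioo (-η) η) (ha hI) N _ hN hB ?_
      y1 hlt') hy1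
    refine le_trans ?_ (Nat.le_mul_of_pos_left w (Nat.succ_pos N))
    rw [hw, vc, vc, Av_empty]
    refine Set.ncard_le_ncard ?_ (wd_finite _ _ _)
    rintro _ ⟨x, ⟨hx, hxU⟩, rfl⟩
    obtain ⟨z, hz, hzz⟩ := ht x hx
    refine ⟨z, hz, ?_⟩
    ext i
    simp only [mem_wd]
    refine and_congr_right fun hi => ?_
    have hne : (powerLawMap a₀ r)^[i] z ≠ 0 := by
      intro h
      exact hxU i hi ⟨hI.iterate i hx, abs_lt.1 ((hzz i hi).2 h)⟩
    exact ((hzz i hi).1 hne).symm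
  · filter_upwards [tube hr c d a₀ N one_pos] with a ht hI
    refine lt_of_le_of_lt (entropy_le_words (plm_mono hr a) (plm_anti hr a) hI (C := max |c| |d|)
      (fun x hx => abs_le_max_abs_abs hx.1 hx.2) ∅
      (fun ε _ => ⟨1, one_pos, fun x hx => absurd hx (notMem_empty x)⟩) N _ hN hB ?_
      y1 hlt') hy1
    set W := wd (powerLawMap a₀ r) N '' Icc c d with hW
    have hWf : W.Finite := wd_finite _ _ _
    have hsub : wd (powerLawMap a r) N '' Icc c d ⊆
        (fun q : ℕ × Finset ℕ => if q.1 < N then symmDiff q.2 {q.1} else q.2) ''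
          (((Finset.range (N + 1) : Finset ℕ) : Set ℕ) ×ˢ W) := by
      rintro _ ⟨x, hx, rfl⟩
      obtain ⟨z, hz, hzz⟩ := ht x hx
      by_cases heq : wd (powerLawMap a r) N x = wd (powerLawMap a₀ r) N z
      · exact ⟨(N, wd (powerLawMap a₀ r) N z), ⟨by simp, z, hz, rfl⟩, by simp [heq]⟩
      · obtain ⟨i, hi⟩ : ∃ i, ¬ (i ∈ wd (powerLawMap a r) N x ↔ i ∈ wd (powerLawMap a₀ r) N z) := by
          by_contra! h
          exact heq (Finset.ext h)
        have hiN : i < N := by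
          by_contra h
          exact hi (by simp [mem_wd, h])
        have hi0 : ∀ j, ¬ (j ∈ wd (powerLawMap a r) N x ↔ j ∈ wd (powerLawMap a₀ r) N z) →
            j < N ∧ (powerLawMap a₀ r)^[j] z = 0 := by
          intro j hj
          have hjN : j < N := by
            by_contra h
            exact hj (by simp [mem_wd, h])
          refine ⟨hjN, ?_⟩
          by_contra hne
          exact hj (by simp only [mem_wd, hjN, true_and]; exact (hzz j hjN).1 hne)
        have hno : ∀ j k, j < k → (powerLawMap a₀ r)^[j] z = 0 →
            (powerLawMap a₀ r)^[k] z = 0 → False := by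
          intro j k hjk h1 h2
          refine hper ⟨h1 ▸ h₀.iterate j hz, k - j, by omega, ?_⟩
          rw [← h1, ← Function.iterate_add_apply, Nat.sub_add_cancel hjk.le, h2, h1]
        refine ⟨(i, wd (powerLawMap a₀ r) N z), ⟨by simp; omega, z, hz, rfl⟩, ?_⟩
        simp only [hiN, if_true]
        ext j
        by_cases hj : j = i
        · subst hj
          simp only [Finset.mem_symmDiff, Finset.mem_singleton]
          tauto
        · have : j ∈ wd (powerLawMap a r) N x ↔ j ∈ wd (powerLawMap a₀ r) N z := by
            by_contra h
            rcases lt_or_gt_of_ne hj with h' | h'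
            · exact hno _ _ h' (hi0 j h).2 (hi0 i hi).2
            · exact hno _ _ h' (hi0 i hi).2 (hi0 j h).2
          simp only [Finset.mem_symmDiff, Finset.mem_singleton]
          tauto
    have hfin := (Finset.finite_toSet (Finset.range (N + 1))).prod hWf
    rw [vc, Av_empty]
    refine (Set.ncard_le_ncard hsub (hfin.image _)).trans ((Set.ncard_image_le hfin).trans ?_)
    rw [Set.ncard_prod, Set.ncard_coe_finset, Finset.card_range, hw, vc, Av_empty]

lemma main {r : ℝ} (hr : 1 < r) (J : Set ℝ) (c d : ℝ) (hcd : c ≤ d)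
    (hmaps : ∀ a ∈ J, Set.MapsTo (powerLawMap a r) (Set.Icc c d) (Set.Icc c d)) :
    ContinuousOn (fun a : ℝ => Dynamics.coverEntropy (powerLawMap a r) (Set.Icc c d)) J := by
  intro a₀ ha₀
  rw [ContinuousWithinAt, tendsto_order]
  constructor
  · intro y hy
    exact (lsc_at hr hcd (hmaps a₀ ha₀) hy).filter_mono nhdsWithin_le_nhds
  · intro y hy
    filter_upwards [(usc_at hr hcd (hmaps a₀ ha₀) hy).filter_mono nhdsWithin_le_nhds,
      self_mem_nhdsWithin] with a h1 h2
    exact h1 (hmaps a h2)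

end PLM

/-- Fix `r > 1`.  Let `J` be an interval of parameters and `I = [c, d]` a compact interval
with `f_a(I) ⊆ I` for every `a ∈ J`.  Then `a ↦ h_top(f_a|_I)` — the topological entropy of
`f_a` restricted to `I`, i.e. Mathlib's Bowen–Dinaburg `Dynamics.coverEntropy` of `f_a` on the set
`I` — is continuous on `J`. -/
theorem continuousOn_entropy_in_parameter (r : ℝ) (hr : 1 < r)
    (J : Set ℝ) (hJ : J.OrdConnected) (c d : ℝ) (hcd : c ≤ d)
    (hmaps : ∀ a ∈ J, Set.MapsTo (powerLawMap a r) (Set.Icc c d) (Set.Icc c d)) :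
    ContinuousOn (fun a : ℝ => Dynamics.coverEntropy (powerLawMap a r) (Set.Icc c d)) J := by
  exact PLM.main hr J c d hcd hmaps
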